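/- arXiv:2505.07221 — 2 statements merged into one kernel-verified Lean document; each statement's English description precedes it below -/
import Mathlib

section
/- Let N and s be positive integers and c=(c_1,…,c_{2s}) a tuple of positive integers. Then Σ over subsets A ⊂ [2s]^{>1}_c containing no pair {2r,2r+1} (r ∈ {1,…,s−1}) of (−1)^{#A}·N^{−#A}·g_N(c−δ_A) equals Σ over even-odd subsets A ⊂ [2s]^1_c of (−1)^{#A/2}·N^{−#A}·h_N(c_{(−A)}). -/
open scoped Classical

/-- The modified multiple harmonic sum `ζ◇_N(k)` for an index given as a list. -/
noncomputable def zdiaL (N : ℕ) (k : List ℕ) : ℚ :=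
  ∑ A : Finset (Fin k.length),
    if ∀ i ∈ A, k.get i = 1 then
      ∑ n ∈ Finset.univ.filter (fun n : Fin k.length → Fin N =>
        (∀ i, 0 < (n i : ℕ)) ∧
        ∀ (i : Fin k.length) (h : (i : ℕ) + 1 < k.length),
          if i ∈ A then n i ≤ n ⟨(i : ℕ) + 1, h⟩ else n i < n ⟨(i : ℕ) + 1, h⟩),
        ∏ i : Fin k.length,
          if i ∈ A then (1 : ℚ) / ((N : ℚ) - ((n i : ℕ) : ℚ))
          else (1 : ℚ) / (((n i : ℕ) : ℚ) ^ k.get i)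
    else 0

/-- The index `({1}^{c₁-1}, c₂+1, {1}^{c₃-1}, c₄+1, …)` built from an even-length
tuple `c`. -/
def buildIdx : List ℕ → List ℕ
  | [] => []
  | [a] => List.replicate (a - 1) 1
  | a :: b :: rest => (List.replicate (a - 1) 1 ++ [b + 1]) ++ buildIdx rest

/-- `modifyIdx c A B` is the tuple `c_{(-A)} - δ_B`: remove the entries of `c` at the
(0-based) positions in `A`, and subtract `1` from each remaining entry whose original
position lies in `B`. -/
def modifyIdx (c : List ℕ) (A B : Finset ℕ) : List ℕ :=
  ((List.range c.length).filter (fun i => i ∉ A)).map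
    (fun i => c.getD i 0 - (if i ∈ B then 1 else 0))

/-- `f_N(c) = ζ◇_N({1}^{c₁-1}, c₂+1, …, {1}^{c_{2s-1}-1}, c_{2s}+1)`. -/
noncomputable def fN (N : ℕ) (c : List ℕ) : ℚ := zdiaL N (buildIdx c)

/-- The auxiliary sum `h_N(c)`.  Positions are 0-based (0-based position `i`
corresponds to the paper's position `i+1`), so even 0-based positions carry the
`1/(N - n)` factors and odd ones the `1/n` factors; the boundary value `n_{0,c₀}` of
the paper is read as `0`. -/
noncomputable def hN (N : ℕ) (c : List ℕ) : ℚ :=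
  ∑ A : Finset (Fin c.length),
    if ∀ i ∈ A, c.get i = 1 then
      (1 / (N : ℚ)) ^ A.card *
      ∑ n ∈ Finset.univ.filter
        (fun n : ∀ i : Fin c.length, Fin (c.get i) → Fin N =>
          (∀ i, Monotone (n i)) ∧
          (∀ (j : Fin c.length) (b : Fin (c.get j)), (b : ℕ) = 0 →
            if (j : ℕ) = 0 then
              (if j ∈ A then (n j b : ℕ) = 0 else 0 < (n j b : ℕ))
            else
              ∀ (j' : Fin c.length) (a : Fin (c.get j')),
                (j' : ℕ) + 1 = (j : ℕ) → (a : ℕ) + 1 = c.get j' →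
                (if j ∈ A then (n j' a : ℕ) = (n j b : ℕ)
                 else (n j' a : ℕ) < (n j b : ℕ)))),
        ∏ i : Fin c.length, ∏ j : Fin (c.get i),
          if i ∈ A then 1
          else if (i : ℕ) % 2 = 0 then (1 : ℚ) / ((N : ℚ) - ((n i j : ℕ) : ℚ))
          else (1 : ℚ) / ((n i j : ℕ) : ℚ)
    else 0

/-- 0-based translation of the paper's (1-based) *even-odd* condition: a union of
(1-based) pairs `{2r, 2r+1}`. -/
def EvenOddZ (A : Finset ℕ) : Prop :=
  ∀ i ∈ A, (i % 2 = 1 → i + 1 ∈ A) ∧ (i % 2 = 0 → 0 < i ∧ i - 1 ∈ A)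

/-- 0-based translation of the paper's (1-based) *odd-even* condition: a union of
(1-based) pairs `{2r-1, 2r}`. -/
def OddEvenZ (A : Finset ℕ) : Prop :=
  ∀ i ∈ A, (i % 2 = 0 → i + 1 ∈ A) ∧ (i % 2 = 1 → i - 1 ∈ A)

/-- `g_N(c) = f_{N+1}(c)`. -/
noncomputable def gN (N : ℕ) (c : List ℕ) : ℚ := fN (N + 1) c

namespace GH

def Tm : Module.End ℚ (ℕ → ℚ) where
  toFun F n := ∑ l ∈ Finset.range n, F l
  map_add' F G := by ext n; simp [Finset.sum_add_distrib]
  map_smul' r F := by ext n; simp [Finset.mul_sum]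

def Wt (w : ℕ → ℚ) : Module.End ℚ (ℕ → ℚ) where
  toFun F n := w n * F n
  map_add' F G := by ext n; simp [mul_add]
  map_smul' r F := by ext n; simp; ring

def Sm : Module.End ℚ (ℕ → ℚ) := Tm + 1

def pw (N n : ℕ) : ℚ := 1 / ((N : ℚ) - (n : ℚ))
def qw (n : ℕ) : ℚ := 1 / (n : ℚ)
def wt (N p n : ℕ) : ℚ := if p % 2 = 0 then pw N n else qw n

def Pm (N : ℕ) := Wt (pw N)
def Qm := Wt qw
def Wm (N p : ℕ) := Wt (wt N p)

lemma Tm_apply (F : ℕ → ℚ) (n : ℕ) : Tm F n = ∑ l ∈ Finset.range n, F l := rfl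
lemma Wt_apply (w F : ℕ → ℚ) (n : ℕ) : Wt w F n = w n * F n := rfl
lemma Sm_apply (F : ℕ → ℚ) (n : ℕ) : Sm F n = Tm F n + F n := rfl
lemma Sm_apply' (F : ℕ → ℚ) (n : ℕ) : Sm F n = ∑ l ∈ Finset.range (n + 1), F l := by
  rw [Finset.sum_range_succ]; rfl
lemma Wm_even (N p : ℕ) (h : p % 2 = 0) : Wm N p = Pm N := by
  unfold Wm Pm; congr 1; ext n; simp [wt, h]
lemma Wm_odd (N p : ℕ) (h : p % 2 = 1) : Wm N p = Qm := by
  unfold Wm Qm; congr 1; ext n; simp [wt, h]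

/-- agreement below `M` -/
def EqB (M : ℕ) (F G : ℕ → ℚ) : Prop := ∀ n < M, F n = G n

lemma EqB.T {M : ℕ} {F G : ℕ → ℚ} (h : EqB M F G) : EqB (M + 1) (Tm F) (Tm G) := by
  intro n hn
  rw [Tm_apply, Tm_apply]
  exact Finset.sum_congr rfl fun l hl => h l (by have := Finset.mem_range.1 hl; omega)
lemma EqB.mono {M M' : ℕ} {F G : ℕ → ℚ} (h : EqB M F G) (hm : M' ≤ M) : EqB M' F G :=
  fun n hn => h n (by omega)
lemma EqB.S {M : ℕ} {F G : ℕ → ℚ} (h : EqB M F G) : EqB M (Sm F) (Sm G) := by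
  intro n hn
  rw [Sm_apply, Sm_apply, h.T n (by omega), h n hn]
lemma EqB.W {M : ℕ} {F G : ℕ → ℚ} (w : ℕ → ℚ) (h : EqB M F G) : EqB M (Wt w F) (Wt w G) := by
  intro n hn
  rw [Wt_apply, Wt_apply, h n hn]
lemma EqB.SW {M : ℕ} {F G : ℕ → ℚ} (w : ℕ → ℚ) (h : EqB M F G) (k : ℕ) :
    EqB M (((Sm * Wt w) ^ k) F) (((Sm * Wt w) ^ k) G) := by
  induction k with
  | zero => simpa using h
  | succ k ih => rw [pow_succ']; exact (ih.W w).S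
lemma EqB.WS {M : ℕ} {F G : ℕ → ℚ} (w : ℕ → ℚ) (h : EqB M F G) (k : ℕ) :
    EqB M (((Wt w * Sm) ^ k) F) (((Wt w * Sm) ^ k) G) := by
  induction k with
  | zero => simpa using h
  | succ k ih => rw [pow_succ']; exact (ih.S).W w

/-- block operators -/
def Xm (N b : ℕ) : Module.End ℚ (ℕ → ℚ) := Pm N * (Sm * Pm N) ^ (b - 1)
def Ym (a : ℕ) : Module.End ℚ (ℕ → ℚ) := (Sm * Qm) ^ a * Tm
def Bm (N p a : ℕ) : Module.End ℚ (ℕ → ℚ) :=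
  Wm N p * (Sm * Wm N p) ^ (a - 1) * Tm + if a = 1 then (1 / (N : ℚ)) • 1 else 0

lemma W_shift (A B : Module.End ℚ (ℕ → ℚ)) (k : ℕ) : A * (B * A) ^ k = (A * B) ^ k * A := by
  induction k with
  | zero => simp
  | succ k ih => rw [pow_succ, ← mul_assoc, ih, pow_succ]; simp only [mul_assoc]

lemma PQ (N : ℕ) (U : ℕ → ℚ) (hU : U 0 = 0) (n : ℕ) (hn : n < N) :
    pw N n * (qw n * U n) = (1 / (N : ℚ)) * (pw N n * U n) + (1 / (N : ℚ)) * (qw n * U n) := by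
  rcases Nat.eq_zero_or_pos n with rfl | h0
  · simp [hU]
  · unfold pw qw
    have h1 : (n : ℚ) ≠ 0 := by positivity
    have h2 : (N : ℚ) ≠ 0 := by have : 0 < N := by omega
                                positivity
    have h3 : (N : ℚ) - n ≠ 0 := by
      have : (n : ℚ) < N := by exact_mod_cast hn
      linarith
    field_simp
    ring

lemma SQT_zero (a : ℕ) (F : ℕ → ℚ) : ((Sm * Qm) ^ a) (Tm F) 0 = 0 := by
  induction a with
  | zero => simp [Tm_apply]
  | succ k ih =>
    rw [pow_succ']
    simp [Sm_apply, Tm_apply, Qm, Wt_apply, Module.End.mul_apply, qw]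

lemma main_step (N a b : ℕ) (F : ℕ → ℚ) : EqB N
    (Xm N (b+1) (Ym (a+1) F) - (if 2 ≤ a + 1 then (1 / (N : ℚ)) • Xm N (b+1) (Ym a F) else 0)
      - (if 2 ≤ b + 1 then (1 / (N : ℚ)) • Xm N b (Ym (a+1) F) else 0))
    (Bm N 0 (b+1) (Bm N 1 (a+1) F) -
      if a + 1 = 1 ∧ b + 1 = 1 then (1 / (N : ℚ)) ^ 2 • F else 0) := by
  have e0 : Wm N 0 = Pm N := Wm_even N 0 rfl
  have e1 : Wm N 1 = Qm := Wm_odd N 1 rfl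
  obtain ⟨U, hUdef⟩ : ∃ U, U = ((Sm * Qm) ^ a) (Tm F) := ⟨_, rfl⟩
  have hU0 : U 0 = 0 := by rw [hUdef]; exact SQT_zero a F
  have hY : Ym a F = U := by rw [hUdef]; rfl
  have hY1 : Ym (a+1) F = Sm (Qm U) := by rw [hUdef, Ym, pow_succ']; rfl
  have hV : EqB N (Pm N (Sm (Qm U)) - (if a = 0 then 0 else (1 / (N : ℚ)) • Pm N U)
        - (if b = 0 then 0 else (1 / (N : ℚ)) • Qm U))
      (Pm N (Tm (Qm U)) + (if a = 0 then (1 / (N : ℚ)) • Pm N U else 0)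
        + (if b = 0 then (1 / (N : ℚ)) • Qm U else 0)) := by
    intro n hn
    have := PQ N U hU0 n hn
    split_ifs <;>
    · simp only [Pm, Qm, Wt_apply, Sm_apply, Pi.sub_apply, Pi.add_apply, Pi.smul_apply, smul_eq_mul,
        Pi.zero_apply]
      linarith
  have hV2 := hV.WS (pw N) b
  change EqB N (((Pm N * Sm) ^ b) _) (((Pm N * Sm) ^ b) _) at hV2
  have hL : (Xm N (b+1) (Ym (a+1) F) - (if 2 ≤ a + 1 then (1 / (N : ℚ)) • Xm N (b+1) (Ym a F) else 0)
      - (if 2 ≤ b + 1 then (1 / (N : ℚ)) • Xm N b (Ym (a+1) F) else 0)) =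
      ((Pm N * Sm) ^ b) (Pm N (Sm (Qm U)) - (if a = 0 then 0 else (1 / (N : ℚ)) • Pm N U)
        - (if b = 0 then 0 else (1 / (N : ℚ)) • Qm U)) := by
    rw [hY, hY1]
    simp only [Xm, Nat.add_sub_cancel, W_shift, Module.End.mul_apply, map_sub]
    congr 1
    · congr 1
      rcases a with _ | a <;> simp
    · rcases b with _ | b
      · simp
      · simp only [Nat.add_sub_cancel, pow_succ]
        simp
  have hR : (Bm N 0 (b+1) (Bm N 1 (a+1) F) -
      if a + 1 = 1 ∧ b + 1 = 1 then (1 / (N : ℚ)) ^ 2 • F else 0) =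
      ((Pm N * Sm) ^ b) (Pm N (Tm (Qm U)) + (if a = 0 then (1 / (N : ℚ)) • Pm N U else 0)
        + (if b = 0 then (1 / (N : ℚ)) • Qm U else 0)) := by
    have h1 : Bm N 1 (a+1) F = Qm U + if a = 0 then (1 / (N : ℚ)) • F else 0 := by
      rw [hUdef]
      unfold Bm
      rw [e1]
      rcases a with _ | a <;> simp
    rw [h1]
    unfold Bm
    rw [e0]
    simp only [Nat.add_sub_cancel, W_shift]
    rcases a with _ | a
    · have hU : U = Tm F := by rw [hUdef]; simp
      rcases b with _ | b
      · simp [hU]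
        module
      · simp [hU]
    · rcases b with _ | b <;> simp
  rw [hL, hR]
  exact hV2

end GH
namespace GH

noncomputable def ev (N m n : ℕ) : ℚ := (n.choose m : ℚ) / (N.choose m : ℚ)

lemma ev_zero (N : ℕ) : ev N 0 = fun _ => 1 := by ext n; simp [ev]

lemma ev_P (N m n : ℕ) (hm : m ≤ N) (hn : n < N) :
    pw N n * ev N m n = ∑ j ∈ Finset.Ico m N, (1 / ((N : ℚ) - j)) * ev N j n := by
  have hN : ev N N n = 0 := by simp [ev, Nat.choose_eq_zero_of_lt hn]
  have key : ∀ j ∈ Finset.Ico m N, (1 / ((N : ℚ) - j)) * ev N j n =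
      pw N n * (ev N j n - ev N (j+1) n) := by
    intro j hj
    have hj := (Finset.mem_Ico.1 hj).2
    have c1 : (N.choose j : ℚ) ≠ 0 := by
      have := Nat.choose_pos hj.le
      positivity
    have c2 : (N.choose (j+1) : ℚ) ≠ 0 := by
      have := Nat.choose_pos (show j + 1 ≤ N from hj)
      positivity
    have h1 : (N : ℚ) - j ≠ 0 := by
      have : (j : ℚ) < N := by exact_mod_cast hj
      linarith
    have h2 : (N : ℚ) - n ≠ 0 := by
      have : (n : ℚ) < N := by exact_mod_cast hn
      linarith
    have r1 : (N.choose (j+1) : ℚ) * (j + 1) = N.choose j * ((N : ℚ) - j) := by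
      have := Nat.choose_succ_right_eq N j
      rw [← Nat.cast_sub hj.le]; exact_mod_cast this
    have r2 : (n.choose (j+1) : ℚ) * (j + 1) = n.choose j * ((n : ℚ) - j) := by
      rcases le_or_gt j n with h | h
      · have := Nat.choose_succ_right_eq n j
        rw [← Nat.cast_sub h]; exact_mod_cast this
      · simp [Nat.choose_eq_zero_of_lt h, Nat.choose_eq_zero_of_lt (show n < j + 1 by omega)]
    have h3 : ((j : ℚ) + 1) ≠ 0 := by positivity
    have r1' : (N.choose (j+1) : ℚ) = N.choose j * ((N : ℚ) - j) / (j + 1) := by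
      field_simp; exact r1
    have r2' : (n.choose (j+1) : ℚ) = n.choose j * ((n : ℚ) - j) / (j + 1) := by
      field_simp; exact r2
    unfold ev pw
    rw [r1', r2']
    field_simp
    ring
  rw [Finset.sum_congr rfl key, ← Finset.mul_sum]
  congr 1
  have := Finset.sum_Ico_sub (fun j => ev N j n) hm
  have h2 : ∑ j ∈ Finset.Ico m N, (ev N j n - ev N (j+1) n) =
      - ∑ j ∈ Finset.Ico m N, (ev N (j+1) n - ev N j n) := by
    rw [← Finset.sum_neg_distrib]; exact Finset.sum_congr rfl fun _ _ => by ring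
  rw [h2, this, hN]; ring

lemma ev_TP (N m n : ℕ) (hm : m ≤ N) (hn : n ≤ N) :
    Tm (Pm N (ev N m)) n = ∑ j ∈ Finset.Ico m N, (1 / ((j + 1 : ℕ) : ℚ)) * ev N (j + 1) n := by
  induction n with
  | zero => simp [Tm_apply, ev]
  | succ n ih =>
    rw [Tm_apply, Finset.sum_range_succ, ← Tm_apply, ih (by omega), Pm, Wt_apply,
      ev_P N m n hm (by omega), ← Finset.sum_add_distrib]
    refine Finset.sum_congr rfl fun j hj => ?_
    have hj := (Finset.mem_Ico.1 hj).2
    have c1 : (N.choose j : ℚ) ≠ 0 := by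
      have := Nat.choose_pos hj.le
      positivity
    have h1 : (N : ℚ) - j ≠ 0 := by
      have : (j : ℚ) < N := by exact_mod_cast hj
      linarith
    have r1 : (N.choose (j+1) : ℚ) * (j + 1) = N.choose j * ((N : ℚ) - j) := by
      have := Nat.choose_succ_right_eq N j
      rw [← Nat.cast_sub hj.le]; exact_mod_cast this
    have h3 : ((j : ℚ) + 1) ≠ 0 := by positivity
    have r1' : (N.choose (j+1) : ℚ) = N.choose j * ((N : ℚ) - j) / (j + 1) := by
      field_simp; exact r1
    unfold ev
    rw [r1', Nat.choose_succ_succ n j]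
    push_cast
    field_simp
    ring

lemma ev_SQ (N m : ℕ) : (Sm * Qm) (ev N (m+1)) = (1 / ((m + 1 : ℕ) : ℚ)) • ev N (m+1) := by
  ext n
  induction n with
  | zero => simp [Sm_apply, Tm_apply, Qm, Wt_apply, qw, ev]
  | succ n ih =>
    have : (Sm * Qm) (ev N (m+1)) (n+1) = (Sm * Qm) (ev N (m+1)) n + Qm (ev N (m+1)) (n+1) := by
      simp only [Module.End.mul_apply, Sm_apply']
      rw [Finset.sum_range_succ _ (n+1)]
    rw [this, ih]
    simp only [Qm, Wt_apply, qw, Pi.smul_apply, smul_eq_mul, ev]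
    have r : ((n + 1 : ℕ) : ℚ) * (n.choose m) = ((n+1).choose (m+1)) * ((m + 1 : ℕ) : ℚ) := by
      exact_mod_cast Nat.add_one_mul_choose_eq n m
    have h1 : ((n + 1 : ℕ) : ℚ) ≠ 0 := by positivity
    have h2 : ((m + 1 : ℕ) : ℚ) ≠ 0 := by positivity
    have p : ((n+1).choose (m+1) : ℚ) = n.choose m + n.choose (m+1) := by
      exact_mod_cast Nat.choose_succ_succ n m
    have r' : (n.choose m : ℚ) = ((n+1).choose (m+1)) * ((m + 1 : ℕ) : ℚ) / ((n + 1 : ℕ) : ℚ) := by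
      rw [eq_div_iff h1, ← r]; ring
    have p' : (n.choose (m+1) : ℚ) = ((n+1).choose (m+1)) - n.choose m := by rw [p]; ring
    rw [p', r']
    field_simp
    ring

lemma ev_SQ_pow (N m b : ℕ) : ((Sm * Qm) ^ b) (ev N (m+1)) =
    ((1 / ((m + 1 : ℕ) : ℚ)) ^ b) • ev N (m+1) := by
  induction b with
  | zero => simp
  | succ b ih => rw [pow_succ, Module.End.mul_apply, ev_SQ, map_smul, ih, smul_smul, pow_succ']

/-- recursive form of the modified harmonic sum (upper bound `N`, lower bound `y`) -/
noncomputable def ZL (N : ℕ) : List ℕ → ℕ → ℚ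
  | [], _ => 1
  | k :: ks, y => ∑ n ∈ Finset.Ico y N,
      ((1 / ((n + 1 : ℕ) : ℚ) ^ k) * ZL N ks (n + 1) +
        if k = 1 then (1 / ((N : ℚ) - n)) * ZL N ks n else 0)

lemma blk (N : ℕ) (L : (ℕ → ℚ) →ₗ[ℚ] ℚ) (hL : ∀ F G, EqB (N+1) F G → L F = L G)
    (k : List ℕ) (hk : ∀ m, 1 ≤ m → m ≤ N → L (ev N m) = ZL N k m) (b : ℕ) (hb : 1 ≤ b) (a m : ℕ)
    (hm : m ≤ N) :
    L (((Sm * Qm) ^ b) (Tm (Pm N (((Sm * Pm N) ^ a) (ev N m))))) =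
      ZL N (List.replicate a 1 ++ (b+1) :: k) m := by
  induction a generalizing m with
  | zero =>
    have h : EqB (N+1) (((Sm * Qm) ^ b) (Tm (Pm N (ev N m))))
        (((Sm * Qm) ^ b) (∑ j ∈ Finset.Ico m N, (1 / ((j + 1 : ℕ) : ℚ)) • ev N (j + 1))) := by
      refine EqB.SW _ (fun n hn => ?_) b
      rw [ev_TP N m n hm (by omega)]
      simp
    simp only [pow_zero, Module.End.one_apply]
    rw [hL _ _ h, map_sum, map_sum]
    simp only [List.replicate_zero, List.nil_append, ZL]
    refine Finset.sum_congr rfl fun j hj => ?_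
    have hj := (Finset.mem_Ico.1 hj).2
    rw [map_smul, map_smul, ev_SQ_pow, map_smul, hk (j+1) (by omega) (by omega), if_neg (by omega),
      smul_eq_mul, smul_eq_mul, add_zero, ← mul_assoc]
    congr 1
    rw [pow_succ, one_div_pow]
    field_simp
  | succ a ih =>
    have h0 : EqB N ((Sm * Pm N) (ev N m)) (∑ j ∈ Finset.Ico m N, ((1 / ((j + 1 : ℕ) : ℚ)) • ev N (j + 1)
        + (1 / ((N : ℚ) - j)) • ev N j)) := by
      intro n hn
      rw [Module.End.mul_apply, Sm_apply, ev_TP N m n hm hn.le, Pm, Wt_apply, ev_P N m n hm hn,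
        ← Finset.sum_add_distrib]
      simp
    have h : EqB (N+1) (((Sm * Qm) ^ b) (Tm (Pm N (((Sm * Pm N) ^ a) ((Sm * Pm N) (ev N m))))))
      (((Sm * Qm) ^ b) (Tm (Pm N (((Sm * Pm N) ^ a) (∑ j ∈ Finset.Ico m N, ((1 / ((j + 1 : ℕ) : ℚ)) • ev N (j + 1)
        + (1 / ((N : ℚ) - j)) • ev N j)))))) :=
      EqB.SW _ (EqB.T (EqB.W _ (EqB.SW _ h0 a))) b
    rw [pow_succ, Module.End.mul_apply, hL _ _ h]
    simp only [map_sum, map_add, map_smul]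
    rw [List.replicate_succ, List.cons_append, ZL]
    refine Finset.sum_congr rfl fun j hj => ?_
    have hj := (Finset.mem_Ico.1 hj).2
    rw [ih (j+1) (by omega), ih j (by omega)]
    simp

def Gd (N : ℕ) : List ℕ → ((ℕ → ℚ) →ₗ[ℚ] ℚ)
  | [] => 0
  | [a] => (LinearMap.proj N : (ℕ → ℚ) →ₗ[ℚ] ℚ) ∘ₗ Ym a
  | a :: b :: rest => Gd N rest ∘ₗ (Xm N b * Ym a)

lemma Ym_eqB (N a : ℕ) (F G : ℕ → ℚ) (h : EqB N F G) : EqB (N+1) (Ym a F) (Ym a G) :=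
  EqB.SW _ h.T a

lemma Xm_eqB (M N a : ℕ) (F G : ℕ → ℚ) (h : EqB M F G) : EqB M (Xm N a F) (Xm N a G) :=
  EqB.W _ (EqB.SW _ h _)

lemma Gd_eqB (N : ℕ) : ∀ (d : List ℕ) (F G : ℕ → ℚ), EqB N F G → Gd N d F = Gd N d G
  | [], _, _, _ => rfl
  | [a], F, G, h => Ym_eqB N a F G h N (by omega)
  | a :: b :: rest, F, G, h => by
    simp only [Gd, LinearMap.comp_apply, Module.End.mul_apply]
    exact Gd_eqB N rest _ _ (Xm_eqB _ _ _ _ _ ((Ym_eqB N a F G h).mono (by omega)))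

lemma Gd_ZL (N : ℕ) : ∀ (d : List ℕ), d.length % 2 = 1 → (∀ x ∈ d, 1 ≤ x) → ∀ c m, m ≤ N →
    Gd N d (Xm N c (ev N m)) = ZL N (buildIdx (c :: d)) m
  | [], h, _, _, _, _ => by simp at h
  | [b], _, hp, c, m, hm => by
    simp only [buildIdx, List.append_nil]
    rw [← blk N (LinearMap.proj N) (fun F G h => h N (by omega)) [] ?_ b (hp b (by simp)) (c-1) m hm]
    · rfl
    · intro m _ hm
      have : (N.choose m : ℚ) ≠ 0 := by
        have := Nat.choose_pos hm
        positivity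
      simp [ev, ZL, this]
  | b :: c' :: rest, hl, hp, c, m, hm => by
    have ih := Gd_ZL N rest (by simp at hl; omega) (fun x hx => hp x (by simp [hx])) c'
    rw [buildIdx, List.append_assoc, List.singleton_append,
      ← blk N (Gd N rest ∘ₗ Xm N c') (fun F G h => ?_) (buildIdx (c' :: rest)) ?_ b (hp b (by simp)) (c-1) m hm]
    · rfl
    · intro m _ hm
      exact ih m hm
    · exact Gd_eqB _ _ _ _ (Xm_eqB _ _ _ _ _ (h.mono (by omega)))

end GH
namespace GH

lemma sum_fin_succ (n : ℕ) (φ : Finset (Fin (n+1)) → ℚ) :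
    ∑ A, φ A = ∑ A : Finset (Fin n), (φ (A.map (Fin.succEmb n)) + φ (insert 0 (A.map (Fin.succEmb n)))) := by
  have h1 : (Finset.univ : Finset (Finset (Fin (n+1)))) =
      (insert 0 (Finset.univ.map (Fin.succEmb n))).powerset := by
    ext A
    simp only [Finset.mem_univ, Finset.mem_powerset, true_iff]
    intro i _
    refine Fin.cases ?_ (fun j => ?_) i <;> simp
  have h2 : (Finset.univ.map (Fin.succEmb n)).powerset =
      (Finset.univ : Finset (Finset (Fin n))).map (Finset.mapEmbedding (Fin.succEmb n)).toEmbedding := by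
    ext A
    simp only [Finset.mem_powerset, Finset.mem_map, Finset.mem_univ, true_and, Finset.subset_map_iff,
      Finset.subset_univ]
    constructor
    · rintro ⟨u, rfl⟩; exact ⟨u, rfl⟩
    · rintro ⟨u, rfl⟩; exact ⟨u, rfl⟩
  rw [h1, Finset.sum_powerset_insert (by simp [Fin.succ_ne_zero]), h2, Finset.sum_map, Finset.sum_map,
    Finset.sum_add_distrib]
  rfl

lemma sum_range_succ_powerset {M : Type*} [AddCommMonoid M] (n : ℕ) (φ : Finset ℕ → M) :
    ∑ A ∈ (Finset.range (n+1)).powerset, φ A =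
      ∑ A ∈ (Finset.range n).powerset, (φ (A.map ⟨Nat.succ, Nat.succ_injective⟩) +
        φ (insert 0 (A.map ⟨Nat.succ, Nat.succ_injective⟩))) := by
  have h1 : Finset.range (n+1) =
      (insert 0 ((Finset.range n).map ⟨Nat.succ, Nat.succ_injective⟩)) := by
    ext i
    rcases i with _ | i <;> simp
  have h2 : ((Finset.range n).map ⟨Nat.succ, Nat.succ_injective⟩).powerset =
      (Finset.range n).powerset.map (Finset.mapEmbedding ⟨Nat.succ, Nat.succ_injective⟩).toEmbedding := by
    ext A
    simp only [Finset.mem_powerset, Finset.mem_map, Finset.subset_map_iff]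
    constructor
    · rintro ⟨u, hu, rfl⟩; exact ⟨u, hu, rfl⟩
    · rintro ⟨u, hu, rfl⟩; exact ⟨u, hu, rfl⟩
  rw [h1, Finset.sum_powerset_insert (by simp), h2, Finset.sum_map, Finset.sum_map,
    Finset.sum_add_distrib]
  rfl

/-- inner part of the modified harmonic sum with lower bound `y` -/
noncomputable def zin (N y : ℕ) (k : List ℕ) (A : Finset (Fin k.length)) : ℚ :=
    if ∀ i ∈ A, k.get i = 1 then
      ∑ n : Fin k.length → Fin N, if 
        (∀ i, y < (n i : ℕ)) ∧
        ∀ (i : Fin k.length) (h : (i : ℕ) + 1 < k.length),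
          if i ∈ A then n i ≤ n ⟨(i : ℕ) + 1, h⟩ else n i < n ⟨(i : ℕ) + 1, h⟩ then
        ∏ i : Fin k.length,
          (if i ∈ A then (1 : ℚ) / ((N : ℚ) - ((n i : ℕ) : ℚ))
          else (1 : ℚ) / (((n i : ℕ) : ℚ) ^ k.get i)) else 0
    else 0

/-- literal version of the modified harmonic sum with lower bound `y` -/
noncomputable def zlit (N y : ℕ) (k : List ℕ) : ℚ :=
  ∑ A : Finset (Fin k.length), zin N y k A

lemma zdiaL_eq (N : ℕ) (k : List ℕ) : zdiaL N k = zlit N 0 k := by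
  unfold zdiaL zlit zin
  simp only [Finset.sum_filter]

lemma sum_fun_succ {n : ℕ} {β : Type} [Fintype β] (φ : (Fin (n+1) → β) → ℚ) :
    ∑ f, φ f = ∑ z : β, ∑ g : Fin n → β, φ (Fin.cons z g) := by
  rw [← Fintype.sum_prod_type' (f := fun z g => φ (Fin.cons z g))]
  exact (Fintype.sum_equiv (Fin.consEquiv (fun _ => β)) _ _ (fun _ => rfl)).symm

lemma zcond (N y : ℕ) (l : ℕ) (A : Finset (Fin l)) (A' : Finset (Fin (l+1)))
    (hA : ∀ i : Fin l, i.succ ∈ A' ↔ i ∈ A) (z : Fin N) (g : Fin l → Fin N) :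
    ((∀ i, y < ((Fin.cons z g : Fin (l+1) → Fin N) i : ℕ)) ∧
        ∀ (i : Fin (l+1)) (h : (i : ℕ) + 1 < l + 1),
          if i ∈ A' then (Fin.cons z g : Fin (l+1) → Fin N) i ≤ (Fin.cons z g : Fin (l+1) → Fin N) ⟨(i : ℕ) + 1, h⟩
          else (Fin.cons z g : Fin (l+1) → Fin N) i < (Fin.cons z g : Fin (l+1) → Fin N) ⟨(i : ℕ) + 1, h⟩) ↔
    (y < (z : ℕ) ∧ ((∀ i, (if 0 ∈ A' then (z : ℕ) - 1 else z) < (g i : ℕ)) ∧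
        ∀ (i : Fin l) (h : (i : ℕ) + 1 < l),
          if i ∈ A then g i ≤ g ⟨(i : ℕ) + 1, h⟩ else g i < g ⟨(i : ℕ) + 1, h⟩)) := by
  have hs : ∀ (i : Fin l) (h : (i : ℕ) + 1 + 1 < l + 1), 
      (Fin.cons z g : Fin (l+1) → Fin N) ⟨(i : ℕ) + 1 + 1, h⟩ = g ⟨(i : ℕ) + 1, by omega⟩ := fun i h => rfl
  rw [Fin.forall_fin_succ, Fin.forall_fin_succ]
  simp only [Fin.cons_zero, Fin.cons_succ, Fin.val_succ, hA, hs, Fin.val_zero]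
  constructor
  · rintro ⟨⟨h1, h2⟩, h3, h4⟩
    refine ⟨h1, ?_, fun i h => h4 i (by omega)⟩
    intro ⟨i, hi⟩
    induction i with
    | zero =>
      have := h3 (by omega)
      have e : (Fin.cons z g : Fin (l+1) → Fin N) ⟨0 + 1, by omega⟩ = g ⟨0, hi⟩ := rfl
      rw [e] at this
      split_ifs at this ⊢ with h0
      · have := Fin.le_def.1 this; omega
      · exact this
    | succ i ih =>
      have a1 := ih (by omega)
      have a2 := h4 ⟨i, by omega⟩ (by simp; omega)
      have a3 : (g ⟨i, by omega⟩ : ℕ) ≤ g ⟨i + 1, hi⟩ := by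
        split_ifs at a2
        · exact a2
        · exact le_of_lt a2
      exact lt_of_lt_of_le a1 a3
  · rintro ⟨h1, h2, h3⟩
    refine ⟨⟨h1, fun i => ?_⟩, ?_, fun i h => h3 i (by omega)⟩
    · have := h2 i
      split_ifs at this <;> omega
    · intro h
      have e : (Fin.cons z g : Fin (l+1) → Fin N) ⟨0 + 1, by omega⟩ = g ⟨0, by omega⟩ := rfl
      rw [e]
      have := h2 ⟨0, by omega⟩
      split_ifs at this ⊢
      · rw [Fin.le_def]; omega
      · exact this

lemma zlit_cons (N y a : ℕ) (k : List ℕ) : zlit N y (a :: k) =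
    ∑ z : Fin N, if y < (z : ℕ) then (1 / ((z : ℕ) : ℚ) ^ a) * zlit N z k +
      (if a = 1 then (1 / ((N : ℚ) - ((z : ℕ) : ℚ))) * zlit N ((z : ℕ) - 1) k else 0) else 0 := by
  have hsum : ∀ A' : Finset (Fin (k.length + 1)), ∀ A : Finset (Fin k.length),
      (∀ i : Fin k.length, i.succ ∈ A' ↔ i ∈ A) → 
      zin N y (a :: k) A' =
      ∑ z : Fin N, if y < (z : ℕ) ∧ (0 ∈ A' → a = 1) then 
        (if 0 ∈ A' then 1 / ((N : ℚ) - ((z : ℕ) : ℚ)) else 1 / ((z : ℕ) : ℚ) ^ a) * 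
        zin N (if 0 ∈ A' then (z : ℕ) - 1 else z) k A else 0 := by
    intro A' A hA
    have hc : (∀ i ∈ A', (a :: k).get i = 1) ↔ (0 ∈ A' → a = 1) ∧ ∀ i ∈ A, k.get i = 1 := by
      constructor
      · intro h
        exact ⟨fun h0 => h 0 h0, fun i hi => h i.succ ((hA i).2 hi)⟩
      · rintro ⟨h1, h2⟩ i
        refine Fin.cases (fun h => h1 h) (fun j hj => h2 j ((hA j).1 hj)) i
    by_cases h1 : 0 ∈ A' → a = 1
    swap
    · rw [show zin N y (a :: k) A' = 0 from if_neg (fun h => h1 (hc.1 h).1)]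
      simp [h1]
    by_cases h2 : ∀ i ∈ A, k.get i = 1
    swap
    · rw [show zin N y (a :: k) A' = 0 from if_neg (fun h => h2 (hc.1 h).2)]
      have hz : ∀ y', zin N y' k A = 0 := fun y' => if_neg h2
      simp [hz]
    refine (show zin N y (a :: k) A' = _ from if_pos (hc.2 ⟨h1, h2⟩)).trans ?_
    refine (sum_fun_succ (n := k.length) _).trans ?_
    refine Finset.sum_congr rfl fun z _ => ?_
    by_cases hy : y < (z : ℕ)
    · rw [if_pos ⟨hy, h1⟩, zin, if_pos h2, Finset.mul_sum]
      refine Finset.sum_congr rfl fun g _ => ?_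
      have := zcond N y k.length A A' hA z g
      rw [mul_ite, mul_zero]
      refine if_congr (this.trans (by simp [hy])) ?_ rfl
      refine (Fin.prod_univ_succ (n := k.length) _).trans ?_
      congr 1
      simp only [Fin.cons_succ, hA]
      rfl
    · rw [if_neg (fun h => hy h.1)]
      refine Finset.sum_eq_zero fun g _ => if_neg ?_
      intro h
      exact hy ((zcond N y k.length A A' hA z g).1 h).1
  unfold zlit
  refine (sum_fin_succ k.length _).trans ?_
  simp_rw [Finset.mul_sum]
  have e1 : ∀ A : Finset (Fin k.length), (0 : Fin (k.length + 1)) ∉ A.map (Fin.succEmb k.length) := by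
    intro A; simp [Fin.succ_ne_zero]
  have e2 : ∀ A : Finset (Fin k.length), ∀ i : Fin k.length, i.succ ∈ A.map (Fin.succEmb k.length) ↔ i ∈ A := by
    intro A i; simp
  have e3 : ∀ A : Finset (Fin k.length), ∀ i : Fin k.length,
      i.succ ∈ insert 0 (A.map (Fin.succEmb k.length)) ↔ i ∈ A := by
    intro A i; simp [Fin.succ_ne_zero]
  refine (Finset.sum_congr rfl fun A _ => congrArg₂ (· + ·) (hsum _ A (e2 A)) (hsum _ A (e3 A))).trans ?_
  simp only [e1, Finset.mem_insert_self, if_true, if_false, ← Finset.sum_add_distrib]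
  rw [Finset.sum_comm]
  refine Finset.sum_congr rfl fun z _ => ?_
  by_cases hy : y < (z : ℕ)
  · by_cases ha : a = 1 
    · simp [hy, ha, Finset.sum_add_distrib]
    · simp [hy, ha]
  · simp [hy]

lemma zlit_ZL (N : ℕ) (k : List ℕ) (y : ℕ) : zlit (N+1) y k = ZL N k y := by
  induction k generalizing y with
  | nil => 
    simp [zlit, zin, ZL]
  | cons a k ih =>
    rw [zlit_cons, ZL, Fin.sum_univ_eq_sum_range (fun z => if y < z then (1 / (z : ℚ) ^ a) * zlit (N+1) z k +
      (if a = 1 then (1 / (((N + 1 : ℕ) : ℚ) - (z : ℚ))) * zlit (N+1) (z - 1) k else 0) else 0) (N+1),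
      Finset.sum_range_succ', ← Finset.sum_filter_add_sum_filter_not (Finset.range N) (fun n => y ≤ n)]
    have : (Finset.range N).filter (fun n => y ≤ n) = Finset.Ico y N := by
      ext i; simp; omega
    rw [this, Finset.sum_eq_zero (s := (Finset.range N).filter (fun n => ¬ y ≤ n))]
    · simp only [not_lt_zero, if_false, add_zero]
      refine Finset.sum_congr rfl fun j hj => ?_
      have hj := (Finset.mem_Ico.1 hj).1
      rw [if_pos (by omega), ih, ih]
      simp
    · intro j hj
      have := (Finset.mem_filter.1 hj).2
      rw [if_neg (by omega)]

lemma gN_eq (N c : ℕ) (d : List ℕ) (h : d.length % 2 = 1) (hp : ∀ x ∈ d, 1 ≤ x) :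
    gN N (c :: d) = Gd N d (Xm N c (fun _ => 1)) := by
  rw [gN, fN, zdiaL_eq, zlit_ZL, ← Gd_ZL N d h hp c 0 (by omega), ev_zero]

end GH
namespace GH

def HC (N l : ℕ) (ℓ : Fin l → ℕ) (x : ℕ) (A : Finset (Fin l)) (n : ∀ i : Fin l, Fin (ℓ i) → Fin N) : Prop :=
  (∀ i, Monotone (n i)) ∧
          (∀ (j : Fin l) (b : Fin (ℓ j)), (b : ℕ) = 0 →
            if (j : ℕ) = 0 then
              (if j ∈ A then (n j b : ℕ) = x else x < (n j b : ℕ))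
            else
              ∀ (j' : Fin l) (a : Fin (ℓ j')),
                (j' : ℕ) + 1 = (j : ℕ) → (a : ℕ) + 1 = ℓ j' →
                (if j ∈ A then (n j' a : ℕ) = (n j b : ℕ)
                 else (n j' a : ℕ) < (n j b : ℕ)))

lemma HC_cons (N l : ℕ) (ℓ : Fin (l+1) → ℕ) (x : ℕ) (A : Finset (Fin l)) (A' : Finset (Fin (l+1)))
    (hA : ∀ i : Fin l, i.succ ∈ A' ↔ i ∈ A)
    (n0 : Fin (ℓ 0) → Fin N) (g : ∀ i : Fin l, Fin (ℓ i.succ) → Fin N)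
    (f t : Fin (ℓ 0)) (hf : (f : ℕ) = 0) (ht : (t : ℕ) + 1 = ℓ 0) :
    HC N (l+1) ℓ x A' (Fin.cons (α := fun i => Fin (ℓ i) → Fin N) n0 g) ↔
      (Monotone n0 ∧ if 0 ∈ A' then (n0 f : ℕ) = x else x < (n0 f : ℕ)) ∧
        HC N l (fun i => ℓ i.succ) (n0 t) A g := by
  unfold HC
  constructor
  · rintro ⟨h1, h2⟩
    refine ⟨⟨h1 0, ?_⟩, fun i => h1 i.succ, ?_⟩
    · have := h2 0 f hf
      simpa using this
    · intro j b hb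
      have := h2 j.succ b hb
      rw [if_neg (by simp)] at this
      by_cases hj : (j : ℕ) = 0
      · rw [if_pos hj]
        have := this 0 t (by simp [hj]) ht
        simp only [hA] at this
        split_ifs at this ⊢
        · exact this.symm
        · exact this
      · rw [if_neg hj]
        intro j' a e1 e2
        have := this j'.succ a (by simp [e1]) e2
        simp only [hA] at this
        exact this
  · rintro ⟨⟨h1, h2⟩, h3, h4⟩
    refine ⟨fun i => ?_, fun j => ?_⟩
    · refine Fin.cases h1 (fun j => h3 j) i
    · refine Fin.cases ?_ (fun j => ?_) j
      · intro b hb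
        have : b = f := Fin.ext (by omega)
        subst this
        simpa using h2
      · intro b hb
        rw [if_neg (by simp)]
        intro j'
        refine Fin.cases ?_ (fun j' => ?_) j'
        · intro a e1 e2
          have : a = t := Fin.ext (by omega)
          subst this
          have hj : (j : ℕ) = 0 := by simpa using e1.symm
          have := h4 j b hb
          rw [if_pos hj] at this
          simp only [hA]
          split_ifs at this ⊢
          · exact this.symm
          · exact this
        · intro a e1 e2
          have := h4 j b hb
          have e1' : (j' : ℕ) + 1 = j := by simpa using e1
          rw [if_neg (by omega)] at this
          have := this j' a e1' e2
          simp only [hA]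
          exact this

noncomputable def hin (N p x : ℕ) (c : List ℕ) (A : Finset (Fin c.length)) : ℚ :=
  if ∀ i ∈ A, c.get i = 1 then
      (1 / (N : ℚ)) ^ A.card *
      ∑ n : (∀ i : Fin c.length, Fin (c.get i) → Fin N), 
        if HC N c.length c.get x A n then
        ∏ i : Fin c.length, (if i ∈ A then 1 else ∏ j : Fin (c.get i), wt N (p + i) (n i j)) else 0
    else 0

noncomputable def hlit (N p x : ℕ) (c : List ℕ) : ℚ := ∑ A : Finset (Fin c.length), hin N p x c A

lemma hN_eq (N : ℕ) (c : List ℕ) : hN N c = hlit N 0 0 c := by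
  unfold hN hlit hin
  refine Finset.sum_congr rfl fun A _ => ?_
  refine if_congr Iff.rfl ?_ rfl
  congr 1
  rw [Finset.sum_filter]
  refine Finset.sum_congr rfl fun n _ => ?_
  refine if_congr Iff.rfl ?_ rfl
  refine Finset.prod_congr rfl fun i _ => ?_
  by_cases h : i ∈ A
  · simp [h]
  · simp [h, wt, pw, qw]

lemma sum_pi_succ {n : ℕ} (β : Fin (n+1) → Type) [∀ i, Fintype (β i)] (φ : (∀ i, β i) → ℚ) :
    ∑ f, φ f = ∑ z : β 0, ∑ g : (∀ i : Fin n, β i.succ), φ (Fin.cons z g) := by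
  rw [← Fintype.sum_prod_type' (f := fun z g => φ (Fin.cons z g))]
  exact (Fintype.sum_equiv (Fin.consEquiv β) _ _ (fun _ => rfl)).symm

lemma hin_cons (N p x a : ℕ) (c : List ℕ) (A : Finset (Fin c.length)) (A' : Finset (Fin (c.length+1)))
    (hA : ∀ i : Fin c.length, i.succ ∈ A' ↔ i ∈ A) (hcard : A'.card = A.card + if 0 ∈ A' then 1 else 0) :
    hin N p x ((a+1) :: c) A' = ∑ n0 : Fin (a+1) → Fin N,
      if (Monotone n0 ∧ if 0 ∈ A' then (n0 0 : ℕ) = x else x < (n0 0 : ℕ)) ∧ (0 ∈ A' → a = 0) then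
        (if 0 ∈ A' then 1 / (N : ℚ) else ∏ j, wt N p (n0 j)) * hin N (p+1) (n0 (Fin.last a)) c A
      else 0 := by
  have hc : (∀ i ∈ A', ((a+1) :: c).get i = 1) ↔ (0 ∈ A' → a = 0) ∧ ∀ i ∈ A, c.get i = 1 := by
    constructor
    · intro h
      exact ⟨fun h0 => by have := h 0 h0; simpa using this, fun i hi => h i.succ ((hA i).2 hi)⟩
    · rintro ⟨h1, h2⟩ i
      refine Fin.cases (fun h => by simpa using h1 h) (fun j hj => h2 j ((hA j).1 hj)) i
  by_cases h1 : 0 ∈ A' → a = 0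
  swap
  · rw [show hin N p x ((a+1) :: c) A' = 0 from if_neg (fun h => h1 (hc.1 h).1)]
    simp [h1]
  by_cases h2 : ∀ i ∈ A, c.get i = 1
  swap
  · rw [show hin N p x ((a+1) :: c) A' = 0 from if_neg (fun h => h2 (hc.1 h).2)]
    have hz : ∀ y', hin N (p+1) y' c A = 0 := fun y' => if_neg h2
    simp [hz]
  refine (show hin N p x ((a+1) :: c) A' = _ from if_pos (hc.2 ⟨h1, h2⟩)).trans ?_
  refine (congrArg _ (sum_pi_succ (fun i : Fin (c.length + 1) => Fin (((a+1) :: c).get i) → Fin N) _)).trans ?_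
  rw [Finset.mul_sum]
  refine Finset.sum_congr rfl fun n0 _ => ?_
  have hcc := fun g => HC_cons N c.length ((a+1) :: c).get x A A' hA n0 g (0 : Fin (a+1)) (Fin.last a) rfl rfl
  by_cases hm : (Monotone n0 ∧ if 0 ∈ A' then (n0 (0 : Fin (a+1)) : ℕ) = x else x < (n0 (0 : Fin (a+1)) : ℕ))
  · refine Eq.trans ?_ (if_pos ⟨hm, h1⟩).symm
    rw [hin, if_pos h2, Finset.mul_sum, Finset.mul_sum, Finset.mul_sum]
    refine Finset.sum_congr rfl fun g _ => ?_
    by_cases hg : HC N c.length c.get (n0 (Fin.last a)) A g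
    · rw [if_pos hg]
      refine (congrArg _ (if_pos ((hcc g).2 ⟨hm, hg⟩))).trans ?_
      refine (congrArg _ (Fin.prod_univ_succ (n := c.length) _)).trans ?_
      have e : ∀ i : Fin c.length, p + (i.succ : ℕ) = p + 1 + i := fun i => by simp; omega
      simp only [hA, e]
      have hk : ((1 : ℚ) / N) ^ A'.card * (if (0 : Fin (c.length + 1)) ∈ A' then (1 : ℚ) else
          ∏ j : Fin (a+1), wt N p (n0 j)) = 
          (if 0 ∈ A' then 1 / (N : ℚ) else ∏ j : Fin (a+1), wt N p (n0 j)) * (1 / N) ^ A.card := by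
        rw [hcard]
        split_ifs
        · rw [pow_succ]; ring
        · simp; ring
      refine (mul_assoc _ _ _).symm.trans ?_
      refine Eq.trans ?_ (mul_assoc _ _ _)
      refine congrArg₂ (· * ·) hk rfl
    · rw [if_neg hg]
      refine (congrArg _ (if_neg (fun h => hg ((hcc g).1 h).2))).trans ?_
      simp
  · refine Eq.trans ?_ (if_neg (fun h => hm h.1)).symm
    rw [Finset.sum_eq_zero, mul_zero]
    intro g _
    exact if_neg (fun h => hm ((hcc g).1 h).1)

lemma hlit_cons (N p x a : ℕ) (c : List ℕ) : hlit N p x ((a+1) :: c) =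
    ∑ n0 : Fin (a+1) → Fin N, if Monotone n0 then 
      (if x < (n0 0 : ℕ) then (∏ j, wt N p (n0 j)) * hlit N (p+1) (n0 (Fin.last a)) c else 0) +
      (if a = 0 ∧ (n0 0 : ℕ) = x then 1 / (N : ℚ) * hlit N (p+1) (n0 (Fin.last a)) c else 0) else 0 := by
  unfold hlit
  refine (sum_fin_succ c.length _).trans ?_
  have e1 : ∀ A : Finset (Fin c.length), (0 : Fin (c.length + 1)) ∉ A.map (Fin.succEmb c.length) := by
    intro A; simp [Fin.succ_ne_zero]
  have e2 : ∀ A : Finset (Fin c.length), ∀ i : Fin c.length, i.succ ∈ A.map (Fin.succEmb c.length) ↔ i ∈ A := by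
    intro A i; simp
  have e3 : ∀ A : Finset (Fin c.length), ∀ i : Fin c.length,
      i.succ ∈ insert 0 (A.map (Fin.succEmb c.length)) ↔ i ∈ A := by
    intro A i; simp [Fin.succ_ne_zero]
  refine (Finset.sum_congr rfl fun A _ => congrArg₂ (· + ·)
    (hin_cons N p x a c A _ (e2 A) (by simp [Fin.succ_ne_zero]))
    (hin_cons N p x a c A _ (e3 A) (by simp [Finset.card_insert_of_notMem (e1 A)]))).trans ?_
  simp only [e1, Finset.mem_insert_self, if_true, if_false, ← Finset.sum_add_distrib]
  rw [Finset.sum_comm]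
  refine Finset.sum_congr rfl fun n0 _ => ?_
  rw [Finset.mul_sum, Finset.mul_sum]
  by_cases hm : Monotone n0
  · by_cases hx : x < (n0 0 : ℕ)
    · have : (n0 0 : ℕ) ≠ x := by omega
      simp [hm, hx, this]
    · by_cases ha : a = 0 <;> by_cases hy : (n0 0 : ℕ) = x <;> simp [hm, ha, hx, hy]
  · simp [hm]

lemma mono_sum (N : ℕ) (w : ℕ → ℚ) (a : ℕ) (F K : ℕ → ℚ) :
    ∑ n0 : Fin (a+1) → Fin N, (if Monotone n0 then
      F (n0 0) * (∏ j, w (n0 j)) * K (n0 (Fin.last a)) else 0) =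
    ∑ y ∈ Finset.range N, (Wt w (((Sm * Wt w) ^ a) F)) y * K y := by
  induction a generalizing F with
  | zero =>
    rw [sum_fun_succ, ← Fin.sum_univ_eq_sum_range (fun y => (Wt w (((Sm * Wt w) ^ 0) F)) y * K y)]
    refine Finset.sum_congr rfl fun z _ => ?_
    have : ∀ g : Fin 0 → Fin N, Monotone (Fin.cons z g : Fin 1 → Fin N) := by
      intro g i j _
      rw [show i = j from Fin.ext (by omega)]
    simp [this, Wt_apply, mul_comm]
  | succ a ih =>
    rw [pow_succ, Module.End.mul_apply, ← ih, sum_fun_succ, Finset.sum_comm]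
    refine Finset.sum_congr rfl fun g _ => ?_
    have hm : ∀ z : Fin N, Monotone (Fin.cons z g : Fin (a+2) → Fin N) ↔ z ≤ g 0 ∧ Monotone g := by
      intro z
      rw [Fin.monotone_iff_le_succ, Fin.monotone_iff_le_succ, Fin.forall_fin_succ]
      rfl
    simp only [hm]
    by_cases hg : Monotone g
    · simp only [hg, and_true, if_true, Fin.cons_zero]
      rw [Module.End.mul_apply, Sm_apply']
      have e : ∀ z : Fin N, (if z ≤ g 0 then F z * (∏ j, w ((Fin.cons z g : Fin (a+2) → Fin N) j)) *
          K ((Fin.cons z g : Fin (a+2) → Fin N) (Fin.last (a+1))) else 0) =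
          (if (z : ℕ) ≤ g 0 then Wt w F z else 0) * (∏ j, w (g j)) * K (g (Fin.last a)) := by
        intro z
        rw [Fin.prod_univ_succ]
        have e2 : (Fin.cons z g : Fin (a+2) → Fin N) (Fin.last (a+1)) = g (Fin.last a) := rfl
        rw [e2]
        simp only [Fin.cons_zero, Fin.cons_succ, Fin.le_def, Wt_apply]
        split_ifs
        · ring
        · ring
      rw [Finset.sum_congr rfl fun z _ => e z, ← Finset.sum_mul, ← Finset.sum_mul]
      congr 2
      rw [Fin.sum_univ_eq_sum_range (fun z => if z ≤ (g 0 : ℕ) then Wt w F z else 0), ← Finset.sum_filter]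
      refine Finset.sum_congr ?_ fun _ _ => rfl
      ext i
      have := (g 0).2
      simp; omega
    · simp [hg]

def Hl (N : ℕ) : ℕ → List ℕ → ((ℕ → ℚ) →ₗ[ℚ] ℚ)
  | _, [] => (LinearMap.proj N : (ℕ → ℚ) →ₗ[ℚ] ℚ) ∘ₗ Tm
  | p, a :: rest => Hl N (p+1) rest ∘ₗ Bm N p a

lemma Hl_eq (N : ℕ) (c : List ℕ) (hc : ∀ x ∈ c, 0 < x) (p : ℕ) (F : ℕ → ℚ) :
    ∑ x ∈ Finset.range N, F x * hlit N p x c = Hl N p c F := by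
  induction c generalizing p F with
  | nil =>
    have : ∀ x, hlit N p x [] = 1 := by
      intro x
      have : (default : Finset (Fin ([] : List ℕ).length)) = ∅ := Finset.eq_empty_of_isEmpty (α := Fin 0) _
      simp [hlit, hin, HC, this]
    simp [this, Hl, Tm_apply]
  | cons a c ih =>
    obtain ⟨a, rfl⟩ : ∃ b, a = b + 1 := ⟨a - 1, by have := hc a (by simp); omega⟩
    have ih := fun p F => ih (fun x hx => hc x (by simp [hx])) p F
    have h1 : Hl N p ((a+1) :: c) F = 
        Hl N (p+1) c (Wm N p (((Sm * Wm N p) ^ a) (Tm F))) +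
        if a = 0 then (1 / (N : ℚ)) * Hl N (p+1) c F else 0 := by
      rcases a with _ | a <;> simp [Hl, Bm]
    rw [h1, ← ih, ← ih, Wm, ← mono_sum]
    simp only [hlit_cons, Finset.mul_sum]
    rw [Finset.sum_comm]
    have h2 : ∀ n0 : Fin (a+1) → Fin N, ∑ x ∈ Finset.range N, F x * (if Monotone n0 then 
      (if x < (n0 0 : ℕ) then (∏ j, wt N p (n0 j)) * hlit N (p+1) (n0 (Fin.last a)) c else 0) +
      (if a = 0 ∧ (n0 0 : ℕ) = x then 1 / (N : ℚ) * hlit N (p+1) (n0 (Fin.last a)) c else 0) else 0) =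
      (if Monotone n0 then
      Tm F (n0 0) * (∏ j, wt N p (n0 j)) * hlit N (p+1) (n0 (Fin.last a)) c else 0) + 
      (if a = 0 then 1 / (N : ℚ) * (F (n0 0) * hlit N (p+1) (n0 0) c) else 0) := by
      intro n0
      by_cases hm : Monotone n0
      · simp only [hm, if_true, mul_add, Finset.sum_add_distrib]
        congr 1
        · rw [Tm_apply, Finset.sum_mul, Finset.sum_mul]
          simp only [mul_ite, mul_zero]
          rw [← Finset.sum_filter]
          refine Finset.sum_congr ?_ fun _ _ => by ring
          ext i
          have := (n0 0).2
          simp; omega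
        · by_cases ha : a = 0
          · subst ha
            simp only [true_and, if_true, mul_ite, mul_zero]
            rw [Finset.sum_ite_eq]
            simp only [Finset.mem_range, Fin.is_lt, if_true]
            simp only [Fin.last_zero]
            ring
          · simp [ha]
      · have ha : a ≠ 0 := by
          rintro rfl
          exact hm (fun i j _ => by rw [show i = j from Fin.ext (by omega)])
        simp [hm, ha]
    rw [Finset.sum_congr rfl fun n0 _ => h2 n0, Finset.sum_add_distrib]
    congr 1
    by_cases ha : a = 0
    · subst ha
      simp only [if_true]
      rw [sum_fun_succ, ← Fin.sum_univ_eq_sum_range (fun x => 1 / (N : ℚ) * (F x * hlit N (p+1) x c)) N]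
      simp
    · simp [ha]

lemma hN_Hl (N : ℕ) (hN0 : 0 < N) (c : List ℕ) (hc : ∀ x ∈ c, 0 < x) :
    hN N c = Hl N 0 c (fun n => if n = 0 then 1 else 0) := by
  rw [hN_eq, ← Hl_eq N c hc]
  simp [hN0]

end GH
namespace GH

def sh (A : Finset ℕ) : Finset ℕ := A.map ⟨Nat.succ, Nat.succ_injective⟩

lemma mem_sh_succ (A : Finset ℕ) (i : ℕ) : i + 1 ∈ sh A ↔ i ∈ A := by simp [sh]
lemma zero_notMem_sh (A : Finset ℕ) : 0 ∉ sh A := by simp [sh]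
lemma card_sh (A : Finset ℕ) : (sh A).card = A.card := by simp [sh]
lemma card_ins (A : Finset ℕ) : (insert 0 (sh A)).card = A.card + 1 := by
  rw [Finset.card_insert_of_notMem (zero_notMem_sh A), card_sh]

lemma sum_sh {M : Type*} [AddCommMonoid M] (n : ℕ) (φ : Finset ℕ → M) :
    ∑ A ∈ (Finset.range (n+1)).powerset, φ A =
      ∑ A ∈ (Finset.range n).powerset, (φ (sh A) + φ (insert 0 (sh A))) :=
  sum_range_succ_powerset n φ

lemma mod_cons (a : ℕ) (c : List ℕ) (A' B' A B : Finset ℕ) (hA : ∀ i, i + 1 ∈ A' ↔ i ∈ A)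
    (hB : ∀ i, i + 1 ∈ B' ↔ i ∈ B) :
    modifyIdx (a :: c) A' B' =
      (if 0 ∈ A' then [] else [a - if 0 ∈ B' then 1 else 0]) ++ modifyIdx c A B := by
  unfold modifyIdx
  rw [List.length_cons, List.range_succ_eq_map, List.filter_cons, List.filter_map]
  by_cases h0 : 0 ∈ A'
  · simp [h0, hA, hB, Function.comp_def]
  · simp [h0, hA, hB, Function.comp_def]

lemma forall_cons (P : ℕ → Prop) (a : ℕ) (c : List ℕ) (A' A : Finset ℕ) (hA : ∀ i, i + 1 ∈ A' ↔ i ∈ A) :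
    (∀ i ∈ A', P ((a :: c).getD i 0)) ↔ (0 ∈ A' → P a) ∧ ∀ i ∈ A, P (c.getD i 0) := by
  constructor
  · intro h
    exact ⟨fun h0 => by simpa using h 0 h0, fun i hi => by simpa using h (i+1) ((hA i).2 hi)⟩
  · rintro ⟨h1, h2⟩ i hi
    rcases i with _ | i
    · simpa using h1 hi
    · simpa using h2 i ((hA i).1 hi)

def NP (A : Finset ℕ) : Prop := ∀ i, i % 2 = 0 → ¬(i ∈ A ∧ i + 1 ∈ A)

lemma NP_cons (A' A : Finset ℕ) (hA : ∀ i, i + 1 + 1 ∈ A' ↔ i ∈ A) :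
    NP A' ↔ ¬ (0 ∈ A' ∧ 1 ∈ A') ∧ NP A := by
  constructor
  · intro h
    refine ⟨h 0 rfl, fun i hi => ?_⟩
    have := h (i + 1 + 1) (by omega)
    rwa [hA, hA (i+1)] at this
  · rintro ⟨h1, h2⟩ i hi
    rcases i with _ | _ | i
    · exact h1
    · omega
    · have := h2 i (by omega)
      rwa [hA, hA (i+1)]

lemma OE_cons (A' A : Finset ℕ) (hA : ∀ i, i + 1 + 1 ∈ A' ↔ i ∈ A) :
    OddEvenZ A' ↔ (0 ∈ A' ↔ 1 ∈ A') ∧ OddEvenZ A := by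
  constructor
  · intro h
    refine ⟨⟨fun h0 => (h 0 h0).1 rfl, fun h1 => (h 1 h1).2 rfl⟩, fun i hi => ?_⟩
    have := h (i + 1 + 1) ((hA i).2 hi)
    refine ⟨fun e => (hA (i+1)).1 (this.1 (by omega)), fun e => ?_⟩
    have h3 := this.2 (by omega)
    obtain ⟨j, rfl⟩ : ∃ j, i = j + 1 := ⟨i - 1, by omega⟩
    exact (hA j).1 h3
  · rintro ⟨h1, h2⟩ i hi
    rcases i with _ | _ | i
    · exact ⟨fun _ => h1.1 hi, by omega⟩
    · exact ⟨by omega, fun _ => h1.2 hi⟩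
    · have := h2 i ((hA i).1 hi)
      refine ⟨fun e => (hA (i+1)).2 (this.1 (by omega)), fun e => ?_⟩
      have h3 := this.2 (by omega)
      obtain ⟨j, rfl⟩ : ∃ j, i = j + 1 := ⟨i - 1, by omega⟩
      exact (hA j).2 h3

noncomputable def LGt (N : ℕ) (d : List ℕ) (A : Finset ℕ) : (ℕ → ℚ) →ₗ[ℚ] ℚ :=
  if (∀ i ∈ A, 2 ≤ d.getD i 0) ∧ NP A then
    ((-1 : ℚ) ^ A.card * (1 / (N : ℚ)) ^ A.card) • Gd N (modifyIdx d ∅ A) else 0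

noncomputable def LG (N : ℕ) (d : List ℕ) : (ℕ → ℚ) →ₗ[ℚ] ℚ :=
  ∑ A ∈ (Finset.range d.length).powerset, LGt N d A

noncomputable def RHt (N : ℕ) (d : List ℕ) (A : Finset ℕ) : (ℕ → ℚ) →ₗ[ℚ] ℚ :=
  if (∀ i ∈ A, d.getD i 0 = 1) ∧ OddEvenZ A then
    ((-1 : ℚ) ^ (A.card / 2) * (1 / (N : ℚ)) ^ A.card) • Hl N 1 (modifyIdx d A ∅) else 0

noncomputable def RH (N : ℕ) (d : List ℕ) : (ℕ → ℚ) →ₗ[ℚ] ℚ :=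
  ∑ A ∈ (Finset.range d.length).powerset, RHt N d A

lemma LG_eqB (N : ℕ) (d : List ℕ) (F G : ℕ → ℚ) (h : EqB N F G) : LG N d F = LG N d G := by
  unfold LG
  rw [LinearMap.sum_apply, LinearMap.sum_apply]
  refine Finset.sum_congr rfl fun A _ => ?_
  unfold LGt
  split_ifs
  · simp [Gd_eqB N _ F G h]
  · rfl

lemma empty_sh (i : ℕ) : i + 1 ∈ (∅ : Finset ℕ) ↔ i ∈ (∅ : Finset ℕ) := by simp

lemma LG_step (N a b : ℕ) (rest : List ℕ) (F : ℕ → ℚ) : LG N (a :: b :: rest) F =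
    LG N rest (Xm N b (Ym a F) - (if 2 ≤ a then (1 / (N : ℚ)) • Xm N b (Ym (a-1) F) else 0)
      - (if 2 ≤ b then (1 / (N : ℚ)) • Xm N (b-1) (Ym a F) else 0)) := by
  have key : ∀ (A' A₁ A : Finset ℕ), (∀ i, i + 1 ∈ A' ↔ i ∈ A₁) → (∀ i, i + 1 ∈ A₁ ↔ i ∈ A) →
      LGt N (a :: b :: rest) A' = 
      if ((0 ∈ A' → 2 ≤ a) ∧ (0 ∈ A₁ → 2 ≤ b) ∧ ¬ (0 ∈ A' ∧ 0 ∈ A₁)) ∧ (∀ i ∈ A, 2 ≤ rest.getD i 0) ∧ NP A then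
      ((-1 : ℚ) ^ A'.card * (1 / (N : ℚ)) ^ A'.card) • Gd N ((a - if 0 ∈ A' then 1 else 0) ::
        (b - if 0 ∈ A₁ then 1 else 0) :: modifyIdx rest ∅ A) else 0 := by
    intro A' A₁ A h1 h2
    unfold LGt
    refine if_congr ?_ ?_ rfl
    · rw [forall_cons (fun x => 2 ≤ x) a _ A' A₁ h1, forall_cons (fun x => 2 ≤ x) b _ A₁ A h2,
        NP_cons A' A (fun i => (h1 _).trans (h2 i)), h1 0]
      tauto
    · rw [mod_cons a _ ∅ A' ∅ A₁ empty_sh h1, mod_cons b _ ∅ A₁ ∅ A empty_sh h2]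
      simp
  have m0 := fun A i => mem_sh_succ A i
  have m1 : ∀ A i, i + 1 ∈ insert 0 (sh A) ↔ i ∈ A := by intro A i; simp [mem_sh_succ]
  unfold LG
  rw [List.length_cons, List.length_cons, sum_sh, sum_sh, LinearMap.sum_apply, LinearMap.sum_apply]
  refine Finset.sum_congr rfl fun A _ => ?_
  rw [key (sh (sh A)) (sh A) A (m0 _) (m0 _), key (insert 0 (sh (sh A))) (sh A) A (m1 _) (m0 _),
    key (sh (insert 0 (sh A))) (insert 0 (sh A)) A (m0 _) (m1 _),
    key (insert 0 (sh (insert 0 (sh A)))) (insert 0 (sh A)) A (m1 _) (m1 _)]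
  simp only [card_sh, card_ins, zero_notMem_sh, Finset.mem_insert_self, Gd]
  unfold LGt
  by_cases hc : (∀ i ∈ A, 2 ≤ rest.getD i 0) ∧ NP A
  · have hcT : ((∀ i ∈ A, 2 ≤ rest.getD i 0) ∧ NP A) = True := eq_true hc
    simp only [hcT, and_true, if_true]
    by_cases ha : 2 ≤ a <;> by_cases hb : 2 ≤ b <;>
    · simp [ha, hb]
      try ring
  · simp only [hc]
    simp

lemma Wm_two (N p : ℕ) : Wm N (p+2) = Wm N p := by
  unfold Wm; congr 1; ext n; simp [wt]

lemma Hl_two (N : ℕ) (c : List ℕ) (p : ℕ) : Hl N (p+2) c = Hl N p c := by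
  induction c generalizing p with
  | nil => rfl
  | cons a c ih =>
    rw [Hl, Hl, show p + 2 + 1 = p + 1 + 2 by ring, ih]
    unfold Bm
    rw [Wm_two]

lemma RH_step (N a b : ℕ) (rest : List ℕ) (F : ℕ → ℚ) : RH N (a :: b :: rest) F =
    RH N rest (Bm N 0 b (Bm N 1 a F) -
      if a = 1 ∧ b = 1 then (1 / (N : ℚ)) ^ 2 • F else 0) := by
  have key : ∀ (A' A₁ A : Finset ℕ), (∀ i, i + 1 ∈ A' ↔ i ∈ A₁) → (∀ i, i + 1 ∈ A₁ ↔ i ∈ A) →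
      RHt N (a :: b :: rest) A' = 
      if ((0 ∈ A' → a = 1) ∧ (0 ∈ A₁ → b = 1) ∧ (0 ∈ A' ↔ 0 ∈ A₁)) ∧ (∀ i ∈ A, rest.getD i 0 = 1) ∧ OddEvenZ A then
      ((-1 : ℚ) ^ (A'.card / 2) * (1 / (N : ℚ)) ^ A'.card) • Hl N 1 ((if 0 ∈ A' then [] else [a]) ++
        ((if 0 ∈ A₁ then [] else [b]) ++ modifyIdx rest A ∅)) else 0 := by
    intro A' A₁ A h1 h2
    unfold RHt
    refine if_congr ?_ ?_ rfl
    · rw [forall_cons (fun x => x = 1) a _ A' A₁ h1, forall_cons (fun x => x = 1) b _ A₁ A h2,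
        OE_cons A' A (fun i => (h1 _).trans (h2 i)), h1 0]
      tauto
    · rw [mod_cons a _ A' ∅ A₁ ∅ h1 empty_sh, mod_cons b _ A₁ ∅ A ∅ h2 empty_sh]
      simp
  have m0 := fun A i => mem_sh_succ A i
  have m1 : ∀ A i, i + 1 ∈ insert 0 (sh A) ↔ i ∈ A := by intro A i; simp [mem_sh_succ]
  have hH : ∀ l, Hl N 1 (a :: b :: l) = Hl N 1 l ∘ₗ Bm N 0 b ∘ₗ Bm N 1 a := by
    intro l
    have : Bm N 2 b = Bm N 0 b := by unfold Bm; rw [← Wm_two N 0]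
    rw [Hl, Hl, Hl_two N l 1, this]
    rfl
  unfold RH
  rw [List.length_cons, List.length_cons, sum_sh, sum_sh, LinearMap.sum_apply, LinearMap.sum_apply]
  refine Finset.sum_congr rfl fun A _ => ?_
  rw [key (sh (sh A)) (sh A) A (m0 _) (m0 _), key (insert 0 (sh (sh A))) (sh A) A (m1 _) (m0 _),
    key (sh (insert 0 (sh A))) (insert 0 (sh A)) A (m0 _) (m1 _),
    key (insert 0 (sh (insert 0 (sh A)))) (insert 0 (sh A)) A (m1 _) (m1 _)]
  simp only [card_sh, card_ins, zero_notMem_sh, Finset.mem_insert_self, if_true, if_false,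
    List.nil_append, List.singleton_append, hH]
  unfold RHt
  have hd : (A.card + 1 + 1) / 2 = A.card / 2 + 1 := by omega
  by_cases hc : (∀ i ∈ A, rest.getD i 0 = 1) ∧ OddEvenZ A
  · have hcT : ((∀ i ∈ A, rest.getD i 0 = 1) ∧ OddEvenZ A) = True := eq_true hc
    simp only [hcT, and_true, if_true]
    by_cases ha : a = 1 <;> by_cases hb : b = 1 <;>
    · simp [ha, hb, hd]
      try ring
  · simp only [hc]
    simp

lemma LG_one (N a : ℕ) (F : ℕ → ℚ) : LG N [a] F =
    Ym a F N - if 2 ≤ a then (1 / (N : ℚ)) * Ym (a-1) F N else 0 := by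
  unfold LG
  rw [List.length_singleton, sum_sh, Finset.range_zero, Finset.powerset_empty, Finset.sum_singleton]
  have h1 : sh ∅ = ∅ := rfl
  have hn : NP ∅ := by intro i; simp
  have hn' : NP {0} := by intro i; simp
  unfold LGt
  by_cases ha : 2 ≤ a <;> simp [h1, hn, hn', ha, modifyIdx, Gd, List.range_succ] <;> ring

lemma RH_one (N a : ℕ) (F : ℕ → ℚ) : RH N [a] F = Tm (Bm N 1 a F) N := by
  unfold RH
  rw [List.length_singleton, sum_sh, Finset.range_zero, Finset.powerset_empty, Finset.sum_singleton]
  have h1 : sh ∅ = ∅ := rfl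
  have hn : OddEvenZ ∅ := by intro i; simp
  have hn' : ¬ OddEvenZ {0} := by intro h; simpa using (h 0 (by simp)).1
  unfold RHt
  simp [h1, hn, hn', modifyIdx, Hl, List.range_succ]

lemma LG_RH (N : ℕ) : ∀ (d : List ℕ), d.length % 2 = 1 → (∀ x ∈ d, 0 < x) → ∀ F, LG N d F = RH N d F
  | [], h, _, _ => by simp at h
  | [a], _, hp, F => by
    rw [LG_one, RH_one]
    obtain ⟨a, rfl⟩ : ∃ b, a = b + 1 := ⟨a - 1, by have := hp a (by simp); omega⟩
    have e1 : Wm N 1 = Qm := Wm_odd N 1 rfl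
    have hY1 : Ym (a+1) F = Sm (Qm (Ym a F)) := by rw [Ym, pow_succ']; rfl
    have hB : Bm N 1 (a+1) F = Qm (Ym a F) + if a = 0 then (1 / (N : ℚ)) • F else 0 := by
      unfold Bm Ym
      rw [e1]
      rcases a with _ | a <;> simp
    have hq : Qm (Ym a F) N = (1 / (N : ℚ)) * Ym a F N := rfl
    rw [hY1, hB, Sm_apply, hq, map_add, Pi.add_apply]
    rcases a with _ | a
    · have : Ym 0 F = Tm F := by simp [Ym]
      simp [this]
    · simp
  | a :: b :: rest, hl, hp, F => by
    have ih := LG_RH N rest (by simp at hl; omega) (fun x hx => hp x (by simp [hx]))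
    rw [LG_step, RH_step, ← ih]
    obtain ⟨a, rfl⟩ : ∃ b, a = b + 1 := ⟨a - 1, by have := hp a (by simp); omega⟩
    obtain ⟨b, rfl⟩ : ∃ c, b = c + 1 := ⟨b - 1, by have := hp b (by simp); omega⟩
    exact LG_eqB N rest _ _ (main_step N a b F)

lemma start_eq (N c : ℕ) : 
    Xm N (c+1) (fun _ => 1) - (if 2 ≤ c + 1 then (1 / (N : ℚ)) • Xm N c (fun _ => 1) else 0) =
      Bm N 0 (c+1) (fun n => if n = 0 then 1 else 0) := by
  have e0 : Wm N 0 = Pm N := Wm_even N 0 rfl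
  have hT : Tm (fun n => if n = 0 then 1 else 0) = (fun _ => 1) - (fun n : ℕ => if n = 0 then (1 : ℚ) else 0) := by
    ext n
    rw [Tm_apply]
    rcases n with _ | n <;> simp
  have hS : Sm (fun n => if n = 0 then 1 else 0) = (fun _ => 1) := by
    ext n
    rw [Sm_apply']
    simp
  have hP : Pm N (fun n => if n = 0 then 1 else 0) = (1 / (N : ℚ)) • (fun n => if n = 0 then 1 else 0) := by
    ext n
    simp only [Pm, Wt_apply, pw, Pi.smul_apply, smul_eq_mul]
    split_ifs with h
    · simp [h]
    · simp
  unfold Bm Xm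
  rw [e0]
  simp only [Nat.add_sub_cancel, W_shift, LinearMap.add_apply, Module.End.mul_apply, hT, map_sub, hP, map_smul]
  rcases c with _ | c
  · simp
  · simp only [Nat.add_sub_cancel, pow_succ, Module.End.mul_apply, hS]
    simp

lemma mem_mod (c : List ℕ) (A B : Finset ℕ) (x : ℕ) (hx : x ∈ modifyIdx c A B) :
    ∃ i, i < c.length ∧ x = c.getD i 0 - (if i ∈ B then 1 else 0) := by
  unfold modifyIdx at hx
  obtain ⟨i, hi, rfl⟩ := List.mem_map.1 hx
  exact ⟨i, by simpa using (List.mem_filter.1 hi).1, rfl⟩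

lemma getD_pos (c : List ℕ) (hp : ∀ x ∈ c, 0 < x) (i : ℕ) (hi : i < c.length) : 0 < c.getD i 0 := by
  rw [List.getD_eq_getElem _ _ hi]
  exact hp _ (List.getElem_mem hi)

lemma length_mod (c : List ℕ) (B : Finset ℕ) : (modifyIdx c ∅ B).length = c.length := by
  simp [modifyIdx]

end GH

/-- **Lemma (g vs h).**  The sum over subsets `A` of the `>1`-positions of `c`
containing no (1-based) pair `{2r, 2r+1}` of `(-1)^{#A} · N^{-#A} · g_N(c - δ_A)`
equals the sum over even-odd subsets `A` of the `1`-positions of `c` of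
`(-1)^{#A/2} · N^{-#A} · h_N(c_{(-A)})`. -/
theorem g_eq_h (N s : ℕ) (hNpos : 0 < N) (hs : 0 < s) (c : List ℕ)
    (hlen : c.length = 2 * s) (hpos : ∀ x ∈ c, 0 < x) :
    (∑ A ∈ (Finset.range c.length).powerset,
      if (∀ i ∈ A, 2 ≤ c.getD i 0) ∧ (∀ i, i % 2 = 1 → ¬(i ∈ A ∧ i + 1 ∈ A)) then
        (-1 : ℚ) ^ A.card * (1 / (N : ℚ)) ^ A.card * gN N (modifyIdx c ∅ A)
      else 0) =
    ∑ A ∈ (Finset.range c.length).powerset,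
      if (∀ i ∈ A, c.getD i 0 = 1) ∧ EvenOddZ A then
        (-1 : ℚ) ^ (A.card / 2) * (1 / (N : ℚ)) ^ A.card * hN N (modifyIdx c A ∅)
      else 0 := by
  classical
  obtain ⟨c, d, rfl⟩ : ∃ x y, c = x :: y := by
    rcases c with _ | ⟨x, y⟩
    · simp at hlen; omega
    · exact ⟨x, y, rfl⟩
  have hd : d.length % 2 = 1 := by simp at hlen; omega
  have hdp : ∀ x ∈ d, 0 < x := fun x hx => hpos x (by simp [hx])
  obtain ⟨c, rfl⟩ : ∃ b, c = b + 1 := ⟨c - 1, by have := hpos c (by simp); omega⟩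
  have m0 := fun A i => GH.mem_sh_succ A i
  have m1 : ∀ A i, i + 1 ∈ insert 0 (GH.sh A) ↔ i ∈ A := by intro A i; simp [GH.mem_sh_succ]
  have hL : ∀ A' A : Finset ℕ, (∀ i, i + 1 ∈ A' ↔ i ∈ A) → A'.card = A.card + (if 0 ∈ A' then 1 else 0) →
      (if (∀ i ∈ A', 2 ≤ ((c+1) :: d).getD i 0) ∧ (∀ i, i % 2 = 1 → ¬(i ∈ A' ∧ i + 1 ∈ A')) then
        (-1 : ℚ) ^ A'.card * (1 / (N : ℚ)) ^ A'.card * gN N (modifyIdx ((c+1) :: d) ∅ A')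
      else 0) =
      if 0 ∈ A' then (if 2 ≤ c + 1 then - (1 / (N : ℚ)) * GH.LGt N d A (GH.Xm N c (fun _ => 1)) else 0)
        else GH.LGt N d A (GH.Xm N (c+1) (fun _ => 1)) := by
    intro A' A h1 hcard
    have hnp : (∀ i, i % 2 = 1 → ¬(i ∈ A' ∧ i + 1 ∈ A')) ↔ GH.NP A := by
      constructor
      · intro h i hi
        have := h (i+1) (by omega)
        rwa [h1, h1] at this
      · intro h i hi
        obtain ⟨j, rfl⟩ : ∃ j, i = j + 1 := ⟨i - 1, by omega⟩
        have := h j (by omega)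
        rwa [h1, h1]
    have hc0 := GH.forall_cons (fun x => 2 ≤ x) (c+1) d A' A h1
    rw [GH.mod_cons (c+1) d ∅ A' ∅ A GH.empty_sh h1]
    by_cases hc : (∀ i ∈ A, 2 ≤ d.getD i 0) ∧ GH.NP A
    · have hg := fun x => GH.gN_eq N x (modifyIdx d ∅ A) (by rw [GH.length_mod]; exact hd) (by
        intro x hx
        obtain ⟨i, hi, rfl⟩ := GH.mem_mod _ _ _ _ hx
        have h3 := GH.getD_pos d hdp i hi
        split_ifs with h
        · have := hc.1 i h; omega
        · omega)
      have hlg : GH.LGt N d A = ((-1 : ℚ) ^ A.card * (1 / (N : ℚ)) ^ A.card) • GH.Gd N (modifyIdx d ∅ A) :=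
        if_pos hc
      by_cases h0 : 0 ∈ A'
      · rw [if_pos h0] at hcard ⊢
        by_cases h2 : 2 ≤ c + 1
        · rw [if_pos ⟨hc0.2 ⟨fun _ => h2, hc.1⟩, hnp.2 hc.2⟩, if_pos h2, hlg, hcard]
          simp only [h0, Finset.notMem_empty, if_true, if_false, Nat.add_sub_cancel, List.singleton_append, hg]
          simp only [LinearMap.smul_apply, smul_eq_mul, pow_succ]
          ring
        · rw [if_neg h2, if_neg (fun h => h2 ((hc0.1 h.1).1 h0))]
          simp [h0]
      · rw [if_neg h0] at hcard ⊢
        rw [if_pos ⟨hc0.2 ⟨fun h => absurd h h0, hc.1⟩, hnp.2 hc.2⟩, hlg, hcard]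
        simp only [h0, Finset.notMem_empty, if_false, Nat.sub_zero, List.singleton_append, hg]
        simp only [LinearMap.smul_apply, smul_eq_mul, add_zero]
    · have hlg : GH.LGt N d A = 0 := if_neg hc
      rw [if_neg (fun h => hc ⟨(hc0.1 h.1).2, hnp.1 h.2⟩), hlg]
      simp
  have hR : ∀ A' A : Finset ℕ, (∀ i, i + 1 ∈ A' ↔ i ∈ A) → A'.card = A.card + (if 0 ∈ A' then 1 else 0) →
      (if (∀ i ∈ A', ((c+1) :: d).getD i 0 = 1) ∧ EvenOddZ A' then
        (-1 : ℚ) ^ (A'.card / 2) * (1 / (N : ℚ)) ^ A'.card * hN N (modifyIdx ((c+1) :: d) A' ∅)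
      else 0) =
      if 0 ∈ A' then 0
        else GH.RHt N d A (GH.Bm N 0 (c+1) (fun n => if n = 0 then 1 else 0)) := by
    intro A' A h1 hcard
    by_cases h0 : 0 ∈ A'
    · rw [if_pos h0, if_neg]
      rintro ⟨_, h⟩
      exact absurd ((h 0 h0).2 rfl).1 (by omega)
    rw [if_neg h0] at hcard ⊢
    have hoe : EvenOddZ A' ↔ OddEvenZ A := by
      constructor
      · intro h i hi
        have := h (i+1) ((h1 i).2 hi)
        refine ⟨fun e => (h1 _).1 (this.1 (by omega)), fun e => ?_⟩
        have h3 := (this.2 (by omega)).2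
        obtain ⟨j, rfl⟩ : ∃ j, i = j + 1 := ⟨i - 1, by omega⟩
        exact (h1 j).1 h3
      · intro h i hi
        obtain ⟨j, rfl⟩ : ∃ j, i = j + 1 := ⟨i - 1, by
          rcases i with _ | i
          · exact absurd hi h0
          · rfl⟩
        have := h j ((h1 j).1 hi)
        refine ⟨fun e => (h1 _).2 (this.1 (by omega)), fun e => ⟨by omega, ?_⟩⟩
        have h3 := this.2 (by omega)
        obtain ⟨k, rfl⟩ : ∃ k, j = k + 1 := ⟨j - 1, by omega⟩
        exact (h1 k).2 h3
    have hc0 := GH.forall_cons (fun x => x = 1) (c+1) d A' A h1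
    unfold GH.RHt
    by_cases hc : (∀ i ∈ A, d.getD i 0 = 1) ∧ OddEvenZ A
    · rw [if_pos ⟨hc0.2 ⟨fun h => absurd h h0, hc.1⟩, hoe.2 hc.2⟩, if_pos hc, hcard,
        GH.mod_cons (c+1) d A' ∅ A ∅ h1 GH.empty_sh, GH.hN_Hl N hNpos]
      · simp only [h0, Finset.notMem_empty, if_false, Nat.sub_zero, List.singleton_append, add_zero]
        rfl
      · intro x hx
        rw [← GH.mod_cons (c+1) d A' ∅ A ∅ h1 GH.empty_sh] at hx
        obtain ⟨i, hi, rfl⟩ := GH.mem_mod _ _ _ _ hx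
        simpa using GH.getD_pos _ hpos i hi
    · rw [if_neg (fun h => hc ⟨(hc0.1 h.1).2, hoe.1 h.2⟩), if_neg hc]
      simp
  rw [List.length_cons, GH.sum_sh, GH.sum_sh]
  have z0 := GH.zero_notMem_sh
  have k0 : ∀ A, (GH.sh A).card = A.card + (if 0 ∈ GH.sh A then 1 else 0) := by
    intro A; simp [z0, GH.card_sh]
  have k1 : ∀ A, (insert 0 (GH.sh A)).card = A.card + (if 0 ∈ insert 0 (GH.sh A) then 1 else 0) := by
    intro A; simp [GH.card_ins]
  rw [Finset.sum_congr rfl fun A _ => congrArg₂ (· + ·) (hL _ A (m0 A) (k0 A)) (hL _ A (m1 A) (k1 A)),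
    Finset.sum_congr rfl fun A _ => congrArg₂ (· + ·) (hR _ A (m0 A) (k0 A)) (hR _ A (m1 A) (k1 A))]
  simp only [z0, Finset.mem_insert_self, if_true, if_false, add_zero]
  have hfin := GH.LG_RH N d hd hdp (GH.Bm N 0 (c+1) (fun n => if n = 0 then 1 else 0))
  rw [← GH.start_eq] at hfin
  have hr : GH.RH N d (GH.Bm N 0 (c+1) (fun n => if n = 0 then 1 else 0)) =
    ∑ A ∈ (Finset.range d.length).powerset, GH.RHt N d A (GH.Bm N 0 (c+1) (fun n => if n = 0 then 1 else 0)) := by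
    rw [GH.RH, LinearMap.sum_apply]
  rw [← hr, ← GH.start_eq, ← hfin, GH.LG, LinearMap.sum_apply]
  refine Finset.sum_congr rfl fun A _ => ?_
  rw [map_sub]
  split_ifs
  · rw [map_smul, smul_eq_mul]; ring
  · simp
end

section
/- Let N and s be positive integers and c=(c_1,…,c_{2s}) a tuple of positive integers, and set (Δf)_N(c) := f_{N+1}(c) − f_N(c). Then (Δf)_N(c) = Σ over even-odd A ⊂ [2s]^1_c and B ⊂ [2s]^{>1}_c with #A+#B ≥ 1 and no pair {2r,2r+1} ⊂ B (r ∈ {1,…,s−1}) of (−1)^{#B−1}·N^{−(#A+#B)}·(Δf)_N(c_{(−A)}−δ_B), plus Σ over even-odd A ⊂ [2s]^1_c and B ⊂ [2s]^{>1}_c with #A+#B ≥ 2 and no pair {2r,2r+1} ⊂ B (r ∈ {1,…,s−1}) of (−1)^{#B−1}·N^{−(#A+#B)}·f_N(c_{(−A)}−δ_B), plus Σ over odd-even A ⊂ [2s]^1_c and B ⊂ [2s]^{>1}_c with #A+#B ≥ 2 and no pair {2r−1,2r} ⊂ B (r ∈ {1,…,s}) of (−1)^{#B}·N^{−(#A+#B)}·f_N(c_{(−A)}−δ_B).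 -/
open scoped Classical

/-- The difference `(Δf)_N(c) = f_{N+1}(c) - f_N(c)`. -/
noncomputable def dfN (N : ℕ) (c : List ℕ) : ℚ := fN (N + 1) c - fN N c

/-! ### Operators -/

theorem sum_Ioo_step (f : ℕ → ℚ) (n N : ℕ) (h : n + 1 < N) :
    ∑ m ∈ Finset.Ioo n N, f m = f (n + 1) + ∑ m ∈ Finset.Ioo (n + 1) N, f m := by
  have e : ∀ n, Finset.Ioo n N = Finset.Ico (n + 1) N := by
    intro n; ext x; simp
  rw [e, e, Finset.sum_eq_sum_Ico_succ_bot h]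

theorem Ioo_empty_aux (n N : ℕ) (h : N ≤ n + 1) : Finset.Ioo n N = ∅ := by
  ext x; simp; omega

noncomputable def opL (N : ℕ) : (ℕ → ℚ) →ₗ[ℚ] (ℕ → ℚ) where
  toFun g n := ∑ m ∈ Finset.Ioo n N, g m
  map_add' g h := by funext n; simp [Finset.sum_add_distrib]
  map_smul' r g := by funext n; simp [Finset.mul_sum]

noncomputable def opS (N : ℕ) : (ℕ → ℚ) →ₗ[ℚ] (ℕ → ℚ) where
  toFun g n := ∑ m ∈ Finset.Ioo n N, (g m / m + g (m - 1) / ((N : ℚ) - m))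
  map_add' g h := by
    funext n; simp only [Pi.add_apply, ← Finset.sum_add_distrib]
    exact Finset.sum_congr rfl fun m _ => by ring
  map_smul' r g := by
    funext n; simp only [Pi.smul_apply, smul_eq_mul, RingHom.id_apply, Finset.mul_sum]
    exact Finset.sum_congr rfl fun m _ => by ring

noncomputable def opQ (b : ℕ) : (ℕ → ℚ) →ₗ[ℚ] (ℕ → ℚ) where
  toFun g n := if b = 0 then 0 else g n / (n : ℚ) ^ (b + 1)
  map_add' g h := by
    funext n; by_cases hb : b = 0 <;> simp [hb, add_div]
  map_smul' r g := by
    funext n; by_cases hb : b = 0 <;> simp [hb, mul_div_assoc]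

noncomputable def opP (N : ℕ) : ℕ → ((ℕ → ℚ) →ₗ[ℚ] (ℕ → ℚ))
  | 0 => 0
  | 1 => opL N
  | a + 2 => opS N ∘ₗ opP N (a + 1)

theorem opP_zero (N : ℕ) (g : ℕ → ℚ) (n : ℕ) : opP N 0 g n = 0 := by simp [opP]

theorem opP_bd (N a : ℕ) (g : ℕ → ℚ) (n : ℕ) (h : N ≤ n + 1) : opP N a g n = 0 := by
  match a with
  | 0 => simp [opP]
  | 1 => simp [opP, opL, Ioo_empty_aux n N h]
  | a + 2 => simp [opP, opS, Ioo_empty_aux n N h]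

theorem opP_one (N : ℕ) (g : ℕ → ℚ) (n : ℕ) (h : n + 1 < N) :
    opP N 1 g n = opP N 1 g (n + 1) + g (n + 1) := by
  simp only [opP, opL, LinearMap.coe_mk, AddHom.coe_mk]
  rw [sum_Ioo_step _ n N h]; ring

theorem opP_succ (N a : ℕ) (g : ℕ → ℚ) (n : ℕ) (h : n + 1 < N) :
    opP N (a + 2) g n = opP N (a + 2) g (n + 1) + opP N (a + 1) g (n + 1) / (n + 1)
      + opP N (a + 1) g n / ((N : ℚ) - (n + 1)) := by
  simp only [opP, opS, LinearMap.coe_mk, AddHom.coe_mk, LinearMap.comp_apply]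
  rw [sum_Ioo_step _ n N h]; push_cast; ring

theorem opP_congr (N a : ℕ) (g h : ℕ → ℚ) (H : ∀ n, 0 < n → n < N → g n = h n) :
    opP N a g = opP N a h := by
  induction a with
  | zero => rfl
  | succ a ih =>
    match a, ih with
    | 0, _ =>
      funext n
      simp only [opP, opL, LinearMap.coe_mk, AddHom.coe_mk]
      refine Finset.sum_congr rfl fun m hm => ?_
      rw [Finset.mem_Ioo] at hm
      exact H m (by omega) hm.2
    | a + 1, ih =>
      change opS N (opP N (a + 1) g) = opS N (opP N (a + 1) h)
      rw [ih]

noncomputable def opU (N a : ℕ) (h : ℕ → ℚ) (n : ℕ) : ℚ :=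
  opP (N + 1) a h n - opP (N + 1) (a - 1) h n / ((N : ℚ) - n)

noncomputable def opV (N b : ℕ) (g : ℕ → ℚ) (n : ℕ) : ℚ :=
  (if b = 1 then g (n - 1) / (N : ℚ) ^ 2 + ((N : ℚ) - n) / ((N : ℚ) ^ 2 * n) * g n else 0)
    + ((N : ℚ) - n) / (N * (n : ℚ) ^ (b + 1)) * g n

theorem opV_congr (N b : ℕ) (g h : ℕ → ℚ) (H : ∀ n, n < N → g n = h n) (n : ℕ) (hn : 0 < n)
    (hnN : n ≤ N) : opV N b g n = opV N b h n := by
  unfold opV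
  rw [H (n - 1) (by omega)]
  rcases hnN.lt_or_eq with h1 | h1
  · rw [H n h1]
  · subst h1; simp

/-- Value of `U` one step to the left. -/
theorem opU_left (N a : ℕ) (h : ℕ → ℚ) (n : ℕ) (hn : n < N) (ha : 0 < a) :
    opU N a h n = opP (N + 1) a h (n + 1) + opP (N + 1) (a - 1) h (n + 1) / (n + 1)
      + (if a = 1 then h (n + 1) else 0) := by
  unfold opU
  match a, ha with
  | 1, _ =>
    rw [opP_one _ _ _ (by omega)]; simp [opP]
  | a + 2, _ =>
    rw [opP_succ _ _ _ _ (by omega)]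
    simp only [show a + 2 - 1 = a + 1 by omega]
    push_cast
    simp

theorem opVU (N a b : ℕ) (h : ℕ → ℚ) (n : ℕ) (hn : 0 < n) (hnN : n ≤ N) (ha : 0 < a)
    (hb : 0 < b) :
    opV N b (opU N a h) n =
      opQ b (opP (N + 1) a h) n - 1 / (N : ℚ) * opQ b (opP (N + 1) (a - 1) h) n
        - 1 / (N : ℚ) * opQ (b - 1) (opP (N + 1) a h) n
        + (if a = 1 ∧ b = 1 then (1 / (N : ℚ)) ^ 2 * h n else 0) := by
  have hN0 : (N : ℚ) ≠ 0 := by exact_mod_cast (show N ≠ 0 by omega)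
  have hn0 : (n : ℚ) ≠ 0 := by positivity
  have hleft := opU_left N a h (n - 1) (by omega) ha
  rw [show n - 1 + 1 = n by omega] at hleft
  have hc : ((n - 1 : ℕ) : ℚ) + 1 = n := by exact_mod_cast (show n - 1 + 1 = n by omega)
  rw [hc] at hleft
  have hright : ((N : ℚ) - n) * opU N a h n =
      ((N : ℚ) - n) * opP (N + 1) a h n - opP (N + 1) (a - 1) h n := by
    unfold opU
    rcases hnN.lt_or_eq with h1 | h1
    · have : (N : ℚ) - n ≠ 0 := by
        have : (n : ℚ) < N := by exact_mod_cast h1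
        linarith
      field_simp
    · subst h1
      simp [opP_bd]
  unfold opV
  rw [hleft]
  generalize opU N a h n = u at *
  simp only [opQ, LinearMap.coe_mk, AddHom.coe_mk]
  generalize opP (N + 1) a h n = p at *
  generalize opP (N + 1) (a - 1) h n = p' at *
  match b, hb with
  | 1, _ =>
    have e1 : ((N : ℚ) - n) / ((N : ℚ) ^ 2 * n) * u = ((N : ℚ) - n) * u / ((N : ℚ) ^ 2 * n) := by
      ring
    have e2 : ((N : ℚ) - n) / (N * (n : ℚ) ^ (1 + 1)) * u
      = ((N : ℚ) - n) * u / (N * (n : ℚ) ^ (1 + 1)) := by ring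
    rw [e1, e2, hright]
    by_cases ha1 : a = 1
    · simp [ha1]; field_simp; ring
    · simp [ha1]; field_simp; ring
  | b + 2, _ =>
    have e2 : ((N : ℚ) - n) / (N * (n : ℚ) ^ (b + 2 + 1)) * u
      = ((N : ℚ) - n) * u / (N * (n : ℚ) ^ (b + 2 + 1)) := by ring
    rw [e2, hright]
    simp
    field_simp
    ring

theorem opV_one (N b : ℕ) (n : ℕ) (hn : 0 < n) (hnN : n ≤ N) (hb : 0 < b) :
    opV N b 1 n = opQ b 1 n - 1 / (N : ℚ) * opQ (b - 1) 1 n := by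
  have hN0 : (N : ℚ) ≠ 0 := by exact_mod_cast (show N ≠ 0 by omega)
  have hn0 : (n : ℚ) ≠ 0 := by positivity
  simp only [opQ, opV, LinearMap.coe_mk, AddHom.coe_mk]
  match b, hb with
  | 1, _ => simp; field_simp; ring
  | b + 2, _ => simp; field_simp; ring

/-- the block operator on the `N` side -/
noncomputable def opO (N a b : ℕ) (g : ℕ → ℚ) (n : ℕ) : ℚ :=
  opP N a (opQ b g) n - 1 / (N : ℚ) * opP N (a - 1) (opQ b g) n
    - 1 / (N : ℚ) * opP N a (opQ (b - 1) g) n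
    + (if a = 1 ∧ b = 1 then (1 / (N : ℚ)) ^ 2 * g n else 0)

theorem opUV (N b : ℕ) (g : ℕ → ℚ) (hb : 0 < b) (a : ℕ) (ha : 0 < a) :
    ∀ d n, n + 1 + d = N → opU N a (opV N b g) n = opO N a b g n := by
  induction a with
  | zero => omega
  | succ a iha =>
  intro d
  induction d with
  | zero =>
    intro n hn
    have hN0 : (N : ℚ) ≠ 0 := by
      have : 0 < N := by omega
      positivity
    rw [opU_left _ _ _ _ (by omega) ha]
    unfold opO
    simp only [opP_bd N _ _ n (show N ≤ n + 1 by omega),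
      opP_bd (N + 1) _ _ (n + 1) (show N + 1 ≤ n + 1 + 1 by omega)]
    simp only [opV]
    have : (N : ℚ) = n + 1 := by exact_mod_cast (show N = n + 1 by omega)
    by_cases h1 : a = 0 <;> by_cases h2 : b = 1 <;> simp [h1, h2, this]
    field_simp
  | succ d ihd =>
    intro n hn
    have hN0 : (N : ℚ) ≠ 0 := by
      have : 0 < N := by omega
      positivity
    have hn0 : (n : ℚ) + 1 ≠ 0 := by positivity
    have hNn : (N : ℚ) - (n + 1) ≠ 0 := by
      have : (N : ℚ) = n + 1 + (d + 1) := by exact_mod_cast hn.symm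
      rw [this]
      have : (d : ℚ) + 1 ≠ 0 := by positivity
      simpa using this
    have hw := ihd (n + 1) (by omega)
    have hl := opU_left N (a + 1) (opV N b g) n (by omega) ha
    match a, iha with
    | 0, _ =>
      have hu : opU N 1 (opV N b g) (n + 1) = opP (N + 1) 1 (opV N b g) (n + 1) := by
        simp [opU, opP]
      simp only [zero_add] at *
      rw [hl, ← hu, hw]
      unfold opO
      rw [opP_one N (opQ b g) n (by omega), opP_one N (opQ (b - 1) g) n (by omega)]
      simp only [opP_zero, Nat.sub_self]
      generalize opP N 1 (opQ b g) (n + 1) = z1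
      generalize opP N 1 (opQ (b - 1) g) (n + 1) = z2
      simp only [opQ, opV, LinearMap.coe_mk, AddHom.coe_mk]
      match b, hb with
      | 1, _ => simp; field_simp; ring
      | b + 2, _ => simp; field_simp; ring
    | a + 1, iha =>
      have hp1 := iha (by omega) (d + 1) n hn
      have hp2 := iha (by omega) d (n + 1) (by omega)
      have hl' := opU_left N (a + 1) (opV N b g) n (by omega) (by omega)
      have key : opU N (a + 1 + 1) (opV N b g) n = opU N (a + 1 + 1) (opV N b g) (n + 1)
          + opU N (a + 1) (opV N b g) (n + 1) / (n + 1)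
          + opU N (a + 1) (opV N b g) n / ((N : ℚ) - (n + 1))
          - (if a = 0 then opV N b g (n + 1) / ((N : ℚ) - (n + 1)) else 0) := by
        rw [hl, hl']
        simp only [opU]
        simp only [Nat.add_sub_cancel]
        push_cast
        by_cases h0 : a = 0 <;> simp [h0] <;> field_simp <;> ring
      rw [key, hw, hp1, hp2]
      match a with
      | 0 =>
        unfold opO
        rw [opP_succ N 0 (opQ b g) n (by omega), opP_succ N 0 (opQ (b - 1) g) n (by omega)]
        simp only [opP_zero, Nat.sub_self, zero_add, Nat.add_sub_cancel]
        rw [opP_one N (opQ b g) n (by omega), opP_one N (opQ (b - 1) g) n (by omega)]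
        generalize opP N _ (opQ b g) (n + 1) = z1
        generalize opP N _ (opQ (b - 1) g) (n + 1) = z2
        generalize opP N _ (opQ b g) (n + 1) = z3
        generalize opP N _ (opQ (b - 1) g) (n + 1) = z4
        simp only [opQ, opV, LinearMap.coe_mk, AddHom.coe_mk]
        match b, hb with
        | 1, _ => simp; field_simp; ring
        | b + 2, _ => simp; field_simp; ring
      | a + 1 =>
        unfold opO
        have e1 : a + 1 + 1 + 1 = (a + 1) + 2 := rfl
        have e2 : a + 1 + 1 = a + 2 := rfl
        simp only [Nat.add_sub_cancel, e1]
        rw [opP_succ N (a + 1) (opQ b g) n (by omega),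
          opP_succ N (a + 1) (opQ (b - 1) g) n (by omega)]
        simp only [e2, show a + 1 + 2 - 1 = a + 2 by omega]
        have := opP_succ N a (opQ b g) n (by omega)
        simp only [this]
        simp
        ring
/-! ### Recursive form of the sums -/

noncomputable def sO {M : Type} [AddCommGroup M] [Module ℚ M] (q : ℚ) :
    List ℕ → (List ℕ → M) → M
  | [], Φ => Φ []
  | [b], Φ => Φ [b] - (if 2 ≤ b then q • Φ [b - 1] else 0)
  | a :: b :: r, Φ => sO q r (fun l => Φ (a :: b :: l))
      - (if 2 ≤ a then q • sO q r (fun l => Φ ((a - 1) :: b :: l)) else 0)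
      - (if 2 ≤ b then q • sO q r (fun l => Φ (a :: (b - 1) :: l)) else 0)
      + (if a = 1 ∧ b = 1 then q ^ 2 • sO q r Φ else 0)

theorem sO_map {M M' : Type} [AddCommGroup M] [Module ℚ M] [AddCommGroup M'] [Module ℚ M']
    (q : ℚ) (T : M →ₗ[ℚ] M') : ∀ (c : List ℕ) (Φ : List ℕ → M),
    T (sO q c Φ) = sO q c (fun l => T (Φ l))
  | [], Φ => by simp [sO]
  | [b], Φ => by simp only [sO]; split_ifs <;> simp
  | a :: b :: r, Φ => by
    simp only [sO, map_sub, map_add, sO_map q T r, apply_ite T, map_smul, map_zero]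

theorem sO_congr {M : Type} [AddCommGroup M] [Module ℚ M] (q : ℚ) :
    ∀ (c : List ℕ) (Φ Ψ : List ℕ → M), (∀ x ∈ c, 0 < x) →
    (∀ l : List ℕ, (∀ x ∈ l, 0 < x) → l.length % 2 = c.length % 2 → Φ l = Ψ l) →
    sO q c Φ = sO q c Ψ
  | [], Φ, Ψ, _, H => by simpa [sO] using H [] (by simp) rfl
  | [b], Φ, Ψ, hp, H => by
    simp only [sO]
    rw [H [b] hp rfl]
    split_ifs with h
    · rw [H [b - 1] (by simp; omega) rfl]
    · rfl
  | a :: b :: r, Φ, Ψ, hp, H => by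
    have hr : ∀ x ∈ r, 0 < x := fun x hx => hp x (by simp [hx])
    have ha : 0 < a := hp a (by simp)
    have hb : 0 < b := hp b (by simp)
    have key : ∀ a' b', 0 < a' → 0 < b' →
        sO q r (fun l => Φ (a' :: b' :: l)) = sO q r (fun l => Ψ (a' :: b' :: l)) := by
      intro a' b' h1 h2
      apply sO_congr q r _ _ hr
      intro l hl hlen
      apply H
      · intro x hx
        simp only [List.mem_cons] at hx
        rcases hx with rfl | rfl | hx
        · exact h1
        · exact h2
        · exact hl x hx
      · simp only [List.length_cons]; omega
    simp only [sO]
    rw [key a b ha hb, sO_congr q r Φ Ψ hr (by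
      intro l hl hlen
      apply H l hl
      simp only [List.length_cons]; omega)]
    congr 2
    · congr 1
      · split_ifs with h
        · rw [key _ _ (by omega) hb]
        · rfl
    · split_ifs with h
      · rw [key _ _ ha (by omega)]
      · rfl

/-! ### Recursive evaluation -/

noncomputable def ev (N : ℕ) : Bool → List ℕ → (ℕ → ℚ)
  | false, [] => 1
  | true, [] => 0
  | false, a :: l => opP N a (ev N true l)
  | true, b :: l => opQ b (ev N false l)

theorem ev_block (N : ℕ) (q : ℚ) (a b : ℕ) (r : List ℕ) (t : Bool)
    (T : ℕ → ℕ → ((ℕ → ℚ) →ₗ[ℚ] (ℕ → ℚ)))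
    (hT : ∀ a b l, ev N t (a :: b :: l) = T a b (ev N t l))
    (hT0 : ∀ b, T 0 b = 0) (hT1 : ∀ a, T a 0 = 0) (ha : 0 < a) (hb : 0 < b) :
    sO q (a :: b :: r) (ev N t) = T a b (sO q r (ev N t)) - q • T (a - 1) b (sO q r (ev N t))
      - q • T a (b - 1) (sO q r (ev N t)) + (if a = 1 ∧ b = 1 then q ^ 2 • sO q r (ev N t) else 0)
      := by
  simp only [sO, hT, ← sO_map q]
  congr 2
  · congr 1
    split_ifs with h
    · rfl
    · rw [show a - 1 = 0 by omega, hT0]; simp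
  · split_ifs with h
    · rfl
    · rw [show b - 1 = 0 by omega, hT1]; simp

theorem opQ_zero : opQ 0 = 0 := by
  apply LinearMap.ext; intro g; funext n; simp [opQ]

theorem O_step (N a b : ℕ) (r : List ℕ) (ha : 0 < a) (hb : 0 < b) :
    sO (1 / (N : ℚ)) (a :: b :: r) (ev N false) = opO N a b (sO (1 / (N : ℚ)) r (ev N false)) := by
  rw [ev_block N _ a b r false (fun a b => opP N a ∘ₗ opQ b) (fun a b l => rfl)
    (fun b => by simp [opP]) (fun a => by simp [opQ_zero]) ha hb]
  funext n
  simp only [opO, LinearMap.comp_apply, Pi.sub_apply, Pi.add_apply, Pi.smul_apply, smul_eq_mul]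
  split_ifs <;> simp

theorem E_step (N : ℕ) (q : ℚ) (a b : ℕ) (r : List ℕ) (ha : 0 < a) (hb : 0 < b) :
    sO q (b :: a :: r) (ev N true) = opQ b (opP N a (sO q r (ev N true)))
      - q • opQ (b - 1) (opP N a (sO q r (ev N true)))
      - q • opQ b (opP N (a - 1) (sO q r (ev N true)))
      + (if b = 1 ∧ a = 1 then q ^ 2 • sO q r (ev N true) else 0) := by
  rw [ev_block N _ b a r true (fun b a => opQ b ∘ₗ opP N a) (fun a b l => rfl)
    (fun b => by simp [opQ_zero]) (fun a => by simp [opP]) hb ha]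
  rfl

theorem main_EV (N : ℕ) : ∀ (b : ℕ) (r : List ℕ), 0 < b → (∀ x ∈ r, 0 < x) →
    r.length % 2 = 0 → ∀ n, 0 < n → n ≤ N →
    sO (1 / (N : ℚ)) (b :: r) (ev (N + 1) true) n
      = opV N b (sO (1 / (N : ℚ)) r (ev N false)) n
  | b, [], hb, _, _, n, hn, hnN => by
    simp only [sO, ev]
    rw [opV_one N b n hn hnN hb]
    split_ifs with h
    · simp
    · rw [show b - 1 = 0 by omega]; simp [opQ_zero]
  | b, [a], hb, _, hl, n, hn, hnN => by simp at hl
  | b, a :: b' :: r, hb, hp, hl, n, hn, hnN => by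
    have hr : ∀ x ∈ r, 0 < x := fun x hx => hp x (by simp [hx])
    have ha : 0 < a := hp a (by simp)
    have hb' : 0 < b' := hp b' (by simp)
    have hl' : r.length % 2 = 0 := by simp only [List.length_cons] at hl; omega
    have ih := main_EV N b' r hb' hr hl'
    rw [E_step _ _ _ _ _ ha hb, O_step _ _ _ _ ha hb']
    set G := sO (1 / (N : ℚ)) r (ev N false)
    set H := sO (1 / (N : ℚ)) (b' :: r) (ev (N + 1) true)
    have hc : ∀ a, opP (N + 1) a H = opP (N + 1) a (opV N b' G) := fun a =>
      opP_congr _ _ _ _ (fun n h1 h2 => ih n h1 (by omega))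
    rw [opV_congr N b (opO N a b' G) (opU N a (opV N b' G))
      (fun n hn => (opUV N b' G hb' a ha (N - n - 1) n (by omega)).symm) n hn hnN,
      opVU N a b _ n hn hnN ha hb]
    simp only [hc, Pi.sub_apply, Pi.add_apply, Pi.smul_apply, smul_eq_mul]
    by_cases h : a = 1 ∧ b = 1
    · rw [if_pos h, if_pos h.symm]
      simp only [Pi.smul_apply, smul_eq_mul, ih n hn hnN]; ring
    · rw [if_neg h, if_neg (fun h' => h h'.symm)]
      simp only [Pi.zero_apply]; ring

/-- The even-odd sum, peeled at the first entry. -/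
noncomputable def sE {M : Type} [AddCommGroup M] [Module ℚ M] (q : ℚ) :
    List ℕ → (List ℕ → M) → M
  | [], Φ => Φ []
  | a :: r, Φ => sO q r (fun l => Φ (a :: l))
      - (if 2 ≤ a then q • sO q r (fun l => Φ ((a - 1) :: l)) else 0)

theorem main_ev (N : ℕ) (hN : 0 < N) (c : List ℕ) (hp : ∀ x ∈ c, 0 < x) (hl : c.length % 2 = 0)
    (hc : c ≠ []) :
    sE (1 / (N : ℚ)) c (ev (N + 1) false) 0 = sO (1 / (N : ℚ)) c (ev N false) 0 := by
  match c, hc with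
  | [a], _ => simp at hl
  | a :: b :: r, _ =>
    have hr : ∀ x ∈ r, 0 < x := fun x hx => hp x (by simp [hx])
    have ha : 0 < a := hp a (by simp)
    have hb : 0 < b := hp b (by simp)
    have hl' : r.length % 2 = 0 := by simp only [List.length_cons] at hl; omega
    rw [O_step _ _ _ _ ha hb, ← opUV N b _ hb a ha (N - 1) 0 (by omega)]
    have e : sE (1 / (N : ℚ)) (a :: b :: r) (ev (N + 1) false) =
        opP (N + 1) a (sO (1 / (N : ℚ)) (b :: r) (ev (N + 1) true))
        - (1 / (N : ℚ)) • opP (N + 1) (a - 1) (sO (1 / (N : ℚ)) (b :: r) (ev (N + 1) true)) := by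
      have e1 : ∀ a', (sO (1 / (N : ℚ)) (b :: r) fun l => ev (N + 1) false (a' :: l)) =
          opP (N + 1) a' (sO (1 / (N : ℚ)) (b :: r) (ev (N + 1) true)) :=
        fun a' => (sO_map _ (opP (N + 1) a') _ _).symm
      simp only [sE, e1]
      split_ifs with h
      · rfl
      · rw [show a - 1 = 0 by omega]; simp [opP]
    rw [e]
    have hcg : ∀ a, opP (N + 1) a (sO (1 / (N : ℚ)) (b :: r) (ev (N + 1) true)) =
      opP (N + 1) a (opV N b (sO (1 / (N : ℚ)) r (ev N false))) := fun a =>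
      opP_congr _ _ _ _ (fun n h1 h2 => main_EV N b r hb hr hl' n h1 (by omega))
    rw [hcg, hcg]
    unfold opU
    simp only [Pi.sub_apply, Pi.smul_apply, smul_eq_mul]
    simp
    ring
/-! ### Splitting subsets -/

def sh (A : Finset ℕ) : Finset ℕ := A.map ⟨Nat.succ, Nat.succ_injective⟩

theorem zero_mem_sh (A : Finset ℕ) : 0 ∈ sh A ↔ False := by simp [sh]

theorem succ_mem_sh (A : Finset ℕ) (i : ℕ) : i + 1 ∈ sh A ↔ i ∈ A := by simp [sh]

theorem one_mem_sh (A : Finset ℕ) : 1 ∈ sh A ↔ 0 ∈ A := succ_mem_sh A 0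

theorem card_sh (A : Finset ℕ) : (sh A).card = A.card := by simp [sh]

theorem card_ins_sh (A : Finset ℕ) : (insert 0 (sh A)).card = A.card + 1 := by
  rw [Finset.card_insert_of_notMem (by rw [zero_mem_sh]; exact id), card_sh]

theorem sh_inj : Function.Injective sh := Finset.map_injective _

theorem sum_ps_succ (n : ℕ) (F : Finset ℕ → ℚ) :
    ∑ A ∈ (Finset.range (n + 1)).powerset, F A =
      ∑ A ∈ (Finset.range n).powerset, (F (sh A) + F (insert 0 (sh A))) := by
  have h1 : Finset.range (n + 1) = insert 0 (sh (Finset.range n)) := by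
    ext i
    cases i with
    | zero => simp
    | succ i => simp [succ_mem_sh]
  have h2 : (sh (Finset.range n)).powerset = (Finset.range n).powerset.image sh := by
    ext A
    simp only [Finset.mem_powerset, Finset.mem_image, sh]
    constructor
    · intro h
      obtain ⟨B, hB, rfl⟩ := Finset.subset_map_iff.1 h
      exact ⟨B, hB, rfl⟩
    · rintro ⟨B, hB, rfl⟩
      exact Finset.map_subset_map.2 hB
  rw [h1, Finset.sum_powerset_insert (by rw [zero_mem_sh]; exact id), h2,
    Finset.sum_image (fun a _ b _ h => sh_inj h), Finset.sum_image (fun a _ b _ h => sh_inj h),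
    ← Finset.sum_add_distrib]

theorem modifyIdx_cons (a : ℕ) (r : List ℕ) (A B A' B' : Finset ℕ)
    (hA : ∀ i, i + 1 ∈ A ↔ i ∈ A') (hB : ∀ i, i + 1 ∈ B ↔ i ∈ B') :
    modifyIdx (a :: r) A B =
      if 0 ∈ A then modifyIdx r A' B' else (a - if 0 ∈ B then 1 else 0) :: modifyIdx r A' B' := by
  unfold modifyIdx
  rw [List.length_cons, List.range_succ_eq_map, List.filter_cons, List.filter_map]
  have e : ((fun i => decide (i ∉ A)) ∘ Nat.succ) = (fun i => decide (i ∉ A')) := by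
    funext i; simp [hA]
  have e2 : ((fun i => (a :: r).getD i 0 - if i ∈ B then 1 else 0) ∘ Nat.succ) =
    (fun i => r.getD i 0 - if i ∈ B' then 1 else 0) := by
    funext i; simp [hB]
  rw [e]
  by_cases h : 0 ∈ A
  · simp only [h, not_true, decide_false, if_true]
    simp [hB]
  · simp only [h, not_false_iff, decide_true, if_true, List.map_cons, List.map_map, e2]
    simp

def condO (c : List ℕ) (A B : Finset ℕ) : Prop :=
  (∀ i ∈ A, c.getD i 0 = 1) ∧ OddEvenZ A ∧ (∀ i ∈ B, 2 ≤ c.getD i 0) ∧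
    (∀ i, i % 2 = 0 → ¬(i ∈ B ∧ i + 1 ∈ B))

def condE (c : List ℕ) (A B : Finset ℕ) : Prop :=
  (∀ i ∈ A, c.getD i 0 = 1) ∧ EvenOddZ A ∧ (∀ i ∈ B, 2 ≤ c.getD i 0) ∧
    (∀ i, i % 2 = 1 → ¬(i ∈ B ∧ i + 1 ∈ B))

noncomputable def tO (q : ℚ) (c : List ℕ) (Φ : List ℕ → ℚ) (A B : Finset ℕ) : ℚ :=
  if condO c A B then (-1 : ℚ) ^ B.card * q ^ (A.card + B.card) * Φ (modifyIdx c A B) else 0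

noncomputable def tE (q : ℚ) (c : List ℕ) (Φ : List ℕ → ℚ) (A B : Finset ℕ) : ℚ :=
  if condE c A B then (-1 : ℚ) ^ B.card * q ^ (A.card + B.card) * Φ (modifyIdx c A B) else 0

theorem forall_nat_succ (p : ℕ → Prop) : (∀ i, p i) ↔ p 0 ∧ ∀ i, p (i + 1) :=
  ⟨fun h => ⟨h 0, fun i => h (i + 1)⟩, fun h i => by
    cases i with
    | zero => exact h.1
    | succ i => exact h.2 i⟩

theorem condO_cons (a b : ℕ) (r : List ℕ) (A B A' B' : Finset ℕ)
    (hA : ∀ i, i + 2 ∈ A ↔ i ∈ A') (hB : ∀ i, i + 2 ∈ B ↔ i ∈ B') :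
    condO (a :: b :: r) A B ↔ ((0 ∈ A → a = 1) ∧ (1 ∈ A → b = 1) ∧ (0 ∈ A ↔ 1 ∈ A) ∧
      (0 ∈ B → 2 ≤ a) ∧ (1 ∈ B → 2 ≤ b) ∧ ¬(0 ∈ B ∧ 1 ∈ B)) ∧ condO r A' B' := by
  have s2 : ∀ p : ℕ → Prop, (∀ i, p i) ↔ p 0 ∧ p 1 ∧ ∀ i, p (i + 2) := fun p => by
    rw [forall_nat_succ, forall_nat_succ (fun i => p (i + 1))]
  have e1 : (∀ i ∈ A, (a :: b :: r).getD i 0 = 1) ↔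
      (0 ∈ A → a = 1) ∧ (1 ∈ A → b = 1) ∧ (∀ i ∈ A', r.getD i 0 = 1) := by
    rw [s2]; simp [hA]
  have e2 : (∀ i ∈ B, 2 ≤ (a :: b :: r).getD i 0) ↔
      (0 ∈ B → 2 ≤ a) ∧ (1 ∈ B → 2 ≤ b) ∧ (∀ i ∈ B', 2 ≤ r.getD i 0) := by
    rw [s2]; simp [hB]
  have e3 : OddEvenZ A ↔ (0 ∈ A ↔ 1 ∈ A) ∧ OddEvenZ A' := by
    unfold OddEvenZ
    rw [s2]
    have : (∀ i, i + 2 ∈ A → ((i + 2) % 2 = 0 → i + 2 + 1 ∈ A) ∧ ((i + 2) % 2 = 1 → i + 2 - 1 ∈ A))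
      ↔ (∀ i ∈ A', (i % 2 = 0 → i + 1 ∈ A') ∧ (i % 2 = 1 → i - 1 ∈ A')) := by
      refine forall_congr' fun i => ?_
      rw [hA, show i + 2 + 1 = (i + 1) + 2 by omega, hA, Nat.add_mod_right]
      refine imp_congr_right fun _ => and_congr_right fun _ => imp_congr_right fun hi => ?_
      rw [show i + 2 - 1 = (i - 1) + 2 by omega, hA]
    rw [this]
    simp
    tauto
  have e4 : (∀ i, i % 2 = 0 → ¬(i ∈ B ∧ i + 1 ∈ B)) ↔ ¬(0 ∈ B ∧ 1 ∈ B) ∧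
      (∀ i, i % 2 = 0 → ¬(i ∈ B' ∧ i + 1 ∈ B')) := by
    rw [s2]
    have : ∀ i, i + 2 + 1 ∈ B ↔ i + 1 ∈ B' := fun i => by
      rw [show i + 2 + 1 = (i + 1) + 2 by omega, hB]
    simp only [hB, Nat.add_mod_right]
    simp
  unfold condO
  rw [e1, e2, e3, e4]
  constructor
  · rintro ⟨⟨h1, h2, h3⟩, ⟨h4, h5⟩, ⟨h6, h7, h8⟩, h9, h10⟩
    exact ⟨⟨h1, h2, h4, h6, h7, h9⟩, h3, h5, h8, h10⟩
  · rintro ⟨⟨h1, h2, h4, h6, h7, h9⟩, h3, h5, h8, h10⟩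
    exact ⟨⟨h1, h2, h3⟩, ⟨h4, h5⟩, ⟨h6, h7, h8⟩, h9, h10⟩

theorem condE_cons (a : ℕ) (r : List ℕ) (A B A' B' : Finset ℕ)
    (hA : ∀ i, i + 1 ∈ A ↔ i ∈ A') (hB : ∀ i, i + 1 ∈ B ↔ i ∈ B') :
    condE (a :: r) A B ↔ (0 ∉ A ∧ (0 ∈ B → 2 ≤ a)) ∧ condO r A' B' := by
  have e1 : (∀ i ∈ A, (a :: r).getD i 0 = 1) ↔
      (0 ∈ A → a = 1) ∧ (∀ i ∈ A', r.getD i 0 = 1) := by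
    rw [forall_nat_succ]; simp [hA]
  have e2 : (∀ i ∈ B, 2 ≤ (a :: r).getD i 0) ↔
      (0 ∈ B → 2 ≤ a) ∧ (∀ i ∈ B', 2 ≤ r.getD i 0) := by
    rw [forall_nat_succ]; simp [hB]
  have e3 : EvenOddZ A ↔ 0 ∉ A ∧ OddEvenZ A' := by
    unfold OddEvenZ EvenOddZ
    rw [forall_nat_succ]
    have : (∀ i, i + 1 ∈ A → ((i + 1) % 2 = 1 → i + 1 + 1 ∈ A) ∧
        ((i + 1) % 2 = 0 → 0 < i + 1 ∧ i + 1 - 1 ∈ A))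
      ↔ (∀ i ∈ A', (i % 2 = 0 → i + 1 ∈ A') ∧ (i % 2 = 1 → i - 1 ∈ A')) := by
      refine forall_congr' fun i => ?_
      rw [hA, hA, show (i + 1) % 2 = 1 ↔ i % 2 = 0 by omega,
        show (i + 1) % 2 = 0 ↔ i % 2 = 1 by omega]
      refine imp_congr_right fun _ => and_congr_right fun _ => imp_congr_right fun hi => ?_
      rw [← hA (i - 1), show i - 1 + 1 = i by omega, show i + 1 - 1 = i by omega]
      simp
    rw [this]
    simp
  have e4 : (∀ i, i % 2 = 1 → ¬(i ∈ B ∧ i + 1 ∈ B)) ↔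
      (∀ i, i % 2 = 0 → ¬(i ∈ B' ∧ i + 1 ∈ B')) := by
    rw [forall_nat_succ]
    simp only [hB, show ∀ i, (i + 1) % 2 = 1 ↔ i % 2 = 0 by omega]
    simp
  unfold condE condO
  rw [e1, e2, e3, e4]
  tauto

noncomputable def SO (q : ℚ) (c : List ℕ) (Φ : List ℕ → ℚ) : ℚ :=
  ∑ A ∈ (Finset.range c.length).powerset, ∑ B ∈ (Finset.range c.length).powerset, tO q c Φ A B

noncomputable def SE (q : ℚ) (c : List ℕ) (Φ : List ℕ → ℚ) : ℚ :=
  ∑ A ∈ (Finset.range c.length).powerset, ∑ B ∈ (Finset.range c.length).powerset, tE q c Φ A B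

theorem mem_ins0 (A : Finset ℕ) : 0 ∈ insert 0 A ↔ True := by simp

theorem succ_mem_ins (A : Finset ℕ) (i : ℕ) : i + 1 ∈ insert 0 A ↔ i + 1 ∈ A := by simp

theorem one_mem_ins (A : Finset ℕ) : 1 ∈ insert 0 A ↔ 1 ∈ A := by simp

theorem tO_cons (q : ℚ) (a b : ℕ) (r : List ℕ) (Φ : List ℕ → ℚ) (A B A1 B1 A' B' : Finset ℕ)
    (hA1 : ∀ i, i + 1 ∈ A ↔ i ∈ A1) (hB1 : ∀ i, i + 1 ∈ B ↔ i ∈ B1)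
    (hA : ∀ i, i + 1 ∈ A1 ↔ i ∈ A') (hB : ∀ i, i + 1 ∈ B1 ↔ i ∈ B') :
    tO q (a :: b :: r) Φ A B =
      if ((0 ∈ A → a = 1) ∧ (0 ∈ A1 → b = 1) ∧ (0 ∈ A ↔ 0 ∈ A1) ∧
      (0 ∈ B → 2 ≤ a) ∧ (0 ∈ B1 → 2 ≤ b) ∧ ¬(0 ∈ B ∧ 0 ∈ B1)) ∧ condO r A' B' then
      (-1 : ℚ) ^ B.card * q ^ (A.card + B.card) *
        Φ (if 0 ∈ A then (if 0 ∈ A1 then modifyIdx r A' B' else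
            (b - if 0 ∈ B1 then 1 else 0) :: modifyIdx r A' B')
          else (a - if 0 ∈ B then 1 else 0) :: (if 0 ∈ A1 then modifyIdx r A' B' else
            (b - if 0 ∈ B1 then 1 else 0) :: modifyIdx r A' B')) else 0 := by
  unfold tO
  rw [modifyIdx_cons a (b :: r) A B A1 B1 hA1 hB1, modifyIdx_cons b r A1 B1 A' B' hA hB]
  rw [condO_cons a b r A B A' B' (fun i => by rw [hA1, hA]) (fun i => by rw [hB1, hB])]
  rw [show (1 ∈ A) = (0 ∈ A1) from propext (hA1 0), show (1 ∈ B) = (0 ∈ B1) from propext (hB1 0)]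
  congr!

theorem SO_eq_sO (q : ℚ) : ∀ (c : List ℕ) (Φ : List ℕ → ℚ), SO q c Φ = sO q c Φ
  | [], Φ => by simp [SO, sO, tO, condO, OddEvenZ, modifyIdx]
  | [b], Φ => by
    simp only [SO, List.length_cons, List.length_nil, sum_ps_succ]
    have hm : ∀ A B A' B' : Finset ℕ, (∀ i, i + 1 ∈ A ↔ i ∈ A') → (∀ i, i + 1 ∈ B ↔ i ∈ B') →
      modifyIdx [b] A B = if 0 ∈ A then [] else [b - if 0 ∈ B then 1 else 0] := by
      intro A B A' B' hA hB
      rw [modifyIdx_cons b [] A B A' B' hA hB]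
      simp [modifyIdx]
    have hm' := fun A B => hm A B (sh ∅) (sh ∅)
    have h1 : sh ∅ = ∅ := by simp [sh]
    simp [h1, tO, condO, OddEvenZ, sO]
    rw [hm ∅ ∅ ∅ ∅ (by simp) (by simp), hm ∅ {0} ∅ ∅ (by simp) (by simp)]
    by_cases h2 : 2 ≤ b <;> simp [h2] <;> ring
  | a :: b :: r, Φ => by
    simp only [sO, smul_eq_mul, ← SO_eq_sO q r]
    simp only [SO, List.length_cons, sum_ps_succ]
    have hmv : ∀ (p : Prop) [Decidable p] (x : ℚ) (F : Finset ℕ → Finset ℕ → ℚ),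
      (if p then x * ∑ A ∈ (Finset.range r.length).powerset,
        ∑ B ∈ (Finset.range r.length).powerset, F A B else 0) =
      ∑ A ∈ (Finset.range r.length).powerset,
        ∑ B ∈ (Finset.range r.length).powerset, (if p then x * F A B else 0) := by
      intro p _ x F
      split_ifs
      · simp only [Finset.mul_sum]
      · simp
    simp only [hmv, ← Finset.sum_add_distrib, ← Finset.sum_sub_distrib]
    refine Finset.sum_congr rfl fun A _ => Finset.sum_congr rfl fun B _ => ?_
    have i1 : ∀ (A : Finset ℕ) i, i + 1 ∈ insert 0 (sh A) ↔ i ∈ A := fun A i => by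
      rw [succ_mem_ins, succ_mem_sh]
    have i2 := succ_mem_sh
    have tt : ∀ X Y A1 B1 : Finset ℕ, X = sh A1 ∨ X = insert 0 (sh A1) →
        Y = sh B1 ∨ Y = insert 0 (sh B1) → A1 = sh A ∨ A1 = insert 0 (sh A) →
        B1 = sh B ∨ B1 = insert 0 (sh B) → _ := fun X Y A1 B1 hX hY hA hB =>
      tO_cons q a b r Φ X Y A1 B1 A B
        (by rcases hX with rfl | rfl <;> [exact i2 _; exact i1 _])
        (by rcases hY with rfl | rfl <;> [exact i2 _; exact i1 _])
        (by rcases hA with rfl | rfl <;> [exact i2 _; exact i1 _])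
        (by rcases hB with rfl | rfl <;> [exact i2 _; exact i1 _])
    rw [tt (sh (sh A)) (sh (sh B)) _ _ (.inl rfl) (.inl rfl) (.inl rfl) (.inl rfl),
      tt (sh (sh A)) (insert 0 (sh (sh B))) _ _ (.inl rfl) (.inr rfl) (.inl rfl) (.inl rfl),
      tt (sh (sh A)) (sh (insert 0 (sh B))) _ _ (.inl rfl) (.inl rfl) (.inl rfl) (.inr rfl),
      tt (sh (sh A)) (insert 0 (sh (insert 0 (sh B)))) _ _ (.inl rfl) (.inr rfl) (.inl rfl) (.inr rfl),
      tt (insert 0 (sh (sh A))) (sh (sh B)) _ _ (.inr rfl) (.inl rfl) (.inl rfl) (.inl rfl),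
      tt (insert 0 (sh (sh A))) (insert 0 (sh (sh B))) _ _ (.inr rfl) (.inr rfl) (.inl rfl) (.inl rfl),
      tt (insert 0 (sh (sh A))) (sh (insert 0 (sh B))) _ _ (.inr rfl) (.inl rfl) (.inl rfl) (.inr rfl),
      tt (insert 0 (sh (sh A))) (insert 0 (sh (insert 0 (sh B)))) _ _ (.inr rfl) (.inr rfl) (.inl rfl) (.inr rfl),
      tt (sh (insert 0 (sh A))) (sh (sh B)) _ _ (.inl rfl) (.inl rfl) (.inr rfl) (.inl rfl),
      tt (sh (insert 0 (sh A))) (insert 0 (sh (sh B))) _ _ (.inl rfl) (.inr rfl) (.inr rfl) (.inl rfl),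
      tt (sh (insert 0 (sh A))) (sh (insert 0 (sh B))) _ _ (.inl rfl) (.inl rfl) (.inr rfl) (.inr rfl),
      tt (sh (insert 0 (sh A))) (insert 0 (sh (insert 0 (sh B)))) _ _ (.inl rfl) (.inr rfl) (.inr rfl) (.inr rfl),
      tt (insert 0 (sh (insert 0 (sh A)))) (sh (sh B)) _ _ (.inr rfl) (.inl rfl) (.inr rfl) (.inl rfl),
      tt (insert 0 (sh (insert 0 (sh A)))) (insert 0 (sh (sh B))) _ _ (.inr rfl) (.inr rfl) (.inr rfl) (.inl rfl),
      tt (insert 0 (sh (insert 0 (sh A)))) (sh (insert 0 (sh B))) _ _ (.inr rfl) (.inl rfl) (.inr rfl) (.inr rfl),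
      tt (insert 0 (sh (insert 0 (sh A)))) (insert 0 (sh (insert 0 (sh B)))) _ _ (.inr rfl) (.inr rfl) (.inr rfl) (.inr rfl)]
    simp only [mem_ins0, zero_mem_sh, card_sh, card_ins_sh, tO]
    by_cases hc : condO r A B
    · by_cases ha : 2 ≤ a <;> by_cases hb : 2 ≤ b <;> by_cases ha1 : a = 1 <;>
        by_cases hb1 : b = 1 <;> first | omega | (simp [hc, ha, hb, ha1, hb1]; try ring)
    · simp [hc]

theorem SE_eq_sE (q : ℚ) (c : List ℕ) (Φ : List ℕ → ℚ) : SE q c Φ = sE q c Φ := by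
  match c with
  | [] => simp [SE, sE, tE, condE, EvenOddZ, modifyIdx]
  | a :: r =>
    simp only [sE, smul_eq_mul, ← SO_eq_sO q r]
    simp only [SE, SO, List.length_cons, sum_ps_succ]
    have hmv : ∀ (p : Prop) [Decidable p] (x : ℚ) (F : Finset ℕ → Finset ℕ → ℚ),
      (if p then x * ∑ A ∈ (Finset.range r.length).powerset,
        ∑ B ∈ (Finset.range r.length).powerset, F A B else 0) =
      ∑ A ∈ (Finset.range r.length).powerset,
        ∑ B ∈ (Finset.range r.length).powerset, (if p then x * F A B else 0) := by
      intro p _ x F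
      split_ifs
      · simp only [Finset.mul_sum]
      · simp
    simp only [hmv, ← Finset.sum_add_distrib, ← Finset.sum_sub_distrib]
    refine Finset.sum_congr rfl fun A _ => Finset.sum_congr rfl fun B _ => ?_
    have i1 : ∀ (A : Finset ℕ) i, i + 1 ∈ insert 0 (sh A) ↔ i ∈ A := fun A i => by
      rw [succ_mem_ins, succ_mem_sh]
    have i2 := succ_mem_sh
    simp only [tE, tO]
    rw [condE_cons a r (sh A) (sh B) A B (i2 A) (i2 B),
      condE_cons a r (sh A) (insert 0 (sh B)) A B (i2 A) (i1 B),
      condE_cons a r (insert 0 (sh A)) (sh B) A B (i1 A) (i2 B),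
      condE_cons a r (insert 0 (sh A)) (insert 0 (sh B)) A B (i1 A) (i1 B),
      modifyIdx_cons a r (sh A) (sh B) A B (i2 A) (i2 B),
      modifyIdx_cons a r (sh A) (insert 0 (sh B)) A B (i2 A) (i1 B)]
    simp only [mem_ins0, zero_mem_sh, card_sh, card_ins_sh]
    by_cases hc : condO r A B
    · by_cases ha : 2 ≤ a <;> (simp [hc, ha]; try ring)
    · simp [hc]
/-! ### The sum `zdiaL` as an iterated sum -/

noncomputable def zc (N : ℕ) : List ℕ → ℕ → ℚ
  | [], _ => 1
  | k :: ks, t => ∑ m ∈ Finset.Ioo t N,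
      (zc N ks m / (m : ℚ) ^ k + if k = 1 then zc N ks (m - 1) / ((N : ℚ) - m) else 0)

def chainC (N l : ℕ) (A : Finset (Fin l)) (n : Fin l → Fin N) : Prop :=
  ∀ (i : Fin l) (h : (i : ℕ) + 1 < l),
    if i ∈ A then n i ≤ n ⟨(i : ℕ) + 1, h⟩ else n i < n ⟨(i : ℕ) + 1, h⟩

noncomputable def zgi (N : ℕ) (k : List ℕ) (t : ℕ) (A : Finset (Fin k.length)) : ℚ :=
  ∑ n : Fin k.length → Fin N,
    if (∀ h : 0 < k.length, t < (n ⟨0, h⟩ : ℕ)) ∧ chainC N k.length A n then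
      ∏ i : Fin k.length,
          if i ∈ A then (1 : ℚ) / ((N : ℚ) - ((n i : ℕ) : ℚ))
          else (1 : ℚ) / (((n i : ℕ) : ℚ) ^ k.get i) else 0

noncomputable def zg (N : ℕ) (k : List ℕ) (t : ℕ) : ℚ :=
  ∑ A : Finset (Fin k.length), if ∀ i ∈ A, k.get i = 1 then zgi N k t A else 0

theorem zdiaL_eq_zg (N : ℕ) (k : List ℕ) : zdiaL N k = zg N k 0 := by
  unfold zdiaL zg zgi
  refine Finset.sum_congr rfl fun A _ => ?_
  refine if_congr Iff.rfl ?_ rfl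
  rw [Finset.sum_filter]
  refine Finset.sum_congr rfl fun n _ => ?_
  refine if_congr ?_ rfl rfl
  constructor
  · rintro ⟨h1, h2⟩
    exact ⟨fun h => h1 _, h2⟩
  · rintro ⟨h1, h2⟩
    refine ⟨?_, h2⟩
    have : ∀ (i : ℕ) (h : i < k.length), 0 < (n ⟨i, h⟩ : ℕ) := by
      intro i
      induction i with
      | zero => exact h1
      | succ i ih =>
        intro h
        have h3 := ih (by omega)
        have h4 := h2 ⟨i, by omega⟩ h
        simp only at h4
        have h5 : n ⟨i, by omega⟩ ≤ n ⟨i + 1, h⟩ := by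
          split_ifs at h4
          · exact h4
          · exact h4.le
        have h6 : (n ⟨i, by omega⟩ : ℕ) ≤ n ⟨i + 1, h⟩ := h5
        omega
    exact fun i => this i i.2

def shF {l : ℕ} (A : Finset (Fin l)) : Finset (Fin (l + 1)) := A.map (Fin.succEmb l)

theorem zero_mem_shF {l : ℕ} (A : Finset (Fin l)) : 0 ∉ shF A := by
  simp [shF, Fin.succ_ne_zero]

theorem succ_mem_shF {l : ℕ} (A : Finset (Fin l)) (i : Fin l) : i.succ ∈ shF A ↔ i ∈ A := by
  simp [shF]

theorem succ_mem_ishF {l : ℕ} (A : Finset (Fin l)) (i : Fin l) :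
    i.succ ∈ insert 0 (shF A) ↔ i ∈ A := by
  simp [shF, Fin.succ_ne_zero]

theorem sum_ps_fin (l : ℕ) (F : Finset (Fin (l + 1)) → ℚ) :
    ∑ A, F A = ∑ A : Finset (Fin l), (F (shF A) + F (insert 0 (shF A))) := by
  have h1 : (Finset.univ : Finset (Fin (l + 1))) = insert 0 (shF Finset.univ) := by
    ext i
    refine Fin.cases ?_ (fun i => ?_) i
    · simp
    · simp [succ_mem_shF]
  have h2 : (shF (Finset.univ : Finset (Fin l))).powerset = Finset.univ.image shF := by
    ext A
    simp only [Finset.mem_powerset, Finset.mem_image, shF]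
    constructor
    · intro h
      obtain ⟨B, hB, rfl⟩ := Finset.subset_map_iff.1 h
      exact ⟨B, Finset.mem_univ _, rfl⟩
    · rintro ⟨B, hB, rfl⟩
      exact Finset.map_subset_map.2 (Finset.subset_univ _)
  have hinj : Function.Injective (shF (l := l)) := Finset.map_injective _
  rw [← Finset.powerset_univ, h1, Finset.sum_powerset_insert (zero_mem_shF _), h2,
    Finset.sum_image (fun a _ b _ h => hinj h), Finset.sum_image (fun a _ b _ h => hinj h),
    ← Finset.sum_add_distrib]

theorem chain_cons (N l : ℕ) (A : Finset (Fin (l + 1))) (A' : Finset (Fin l))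
    (hA : ∀ i : Fin l, i.succ ∈ A ↔ i ∈ A') (m : Fin N) (n : Fin l → Fin N) (hm : 0 < (m : ℕ)) :
    chainC N (l + 1) A (Fin.cons m n : Fin (l + 1) → Fin N) ↔
      (∀ h : 0 < l, (if 0 ∈ A then (m : ℕ) - 1 else m) < (n ⟨0, h⟩ : ℕ)) ∧ chainC N l A' n := by
  unfold chainC
  rw [Fin.forall_fin_succ]
  refine and_congr ?_ ?_
  · constructor
    · intro H h
      have h1 := H (by simpa using h)
      have e : (⟨((0 : Fin (l + 1)) : ℕ) + 1, by simpa using h⟩ : Fin (l + 1)) = Fin.succ ⟨0, h⟩ := rfl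
      rw [e, Fin.cons_succ, Fin.cons_zero] at h1
      split_ifs at h1 ⊢
      · have : (m : ℕ) ≤ n ⟨0, h⟩ := h1
        omega
      · exact h1
    · intro H h
      have h' : 0 < l := by simpa using h
      have h1 := H h'
      have e : (⟨((0 : Fin (l + 1)) : ℕ) + 1, h⟩ : Fin (l + 1)) = Fin.succ ⟨0, h'⟩ := rfl
      rw [e, Fin.cons_succ, Fin.cons_zero]
      split_ifs at h1 ⊢
      · rw [Fin.le_def]; omega
      · exact h1
  · refine forall_congr' fun i => ?_
    constructor
    · intro H h
      have h1 := H (by simpa using h)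
      have e : (⟨((i.succ : Fin (l + 1)) : ℕ) + 1, by simpa using h⟩ : Fin (l + 1))
        = Fin.succ ⟨i + 1, h⟩ := rfl
      rw [e, Fin.cons_succ, Fin.cons_succ] at h1
      simpa only [hA] using h1
    · intro H h
      have h' : (i : ℕ) + 1 < l := by simpa using h
      have h1 := H h'
      have e : (⟨((i.succ : Fin (l + 1)) : ℕ) + 1, h⟩ : Fin (l + 1))
        = Fin.succ ⟨i + 1, h'⟩ := rfl
      rw [e, Fin.cons_succ, Fin.cons_succ]
      simpa only [hA] using h1

theorem zgi_cons (N a : ℕ) (k : List ℕ) (t : ℕ) (A : Finset (Fin (k.length + 1)))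
    (A' : Finset (Fin k.length)) (hA : ∀ i : Fin k.length, i.succ ∈ A ↔ i ∈ A') :
    zgi N (a :: k) t A = ∑ m ∈ Finset.Ioo t N,
      (if 0 ∈ A then 1 / ((N : ℚ) - m) else 1 / (m : ℚ) ^ a) *
        zgi N k (if 0 ∈ A then m - 1 else m) A' := by
  have e0 : zgi N (a :: k) t A = ∑ n : Fin (k.length + 1) → Fin N,
    if (t < (n 0 : ℕ)) ∧ chainC N (k.length + 1) A n then
      (if 0 ∈ A then (1 : ℚ) / ((N : ℚ) - ((n 0 : ℕ) : ℚ))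
          else (1 : ℚ) / (((n 0 : ℕ) : ℚ) ^ a)) *
      ∏ i : Fin k.length,
          if i ∈ A' then (1 : ℚ) / ((N : ℚ) - ((n i.succ : ℕ) : ℚ))
          else (1 : ℚ) / (((n i.succ : ℕ) : ℚ) ^ k.get i) else 0 := by
    unfold zgi
    refine Finset.sum_congr rfl fun n _ => ?_
    refine if_congr ?_ ?_ rfl
    · refine and_congr ?_ Iff.rfl
      exact ⟨fun h => h (Nat.succ_pos _), fun h _ => h⟩
    · rw [show (∏ i : Fin (a :: k).length, if i ∈ A then (1 : ℚ) / ((N : ℚ) - ((n i : ℕ) : ℚ))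
          else (1 : ℚ) / (((n i : ℕ) : ℚ) ^ (a :: k).get i)) = _ from Fin.prod_univ_succ _]
      simp only [hA]
      rfl
  rw [e0, ← (Fin.consEquiv (fun _ : Fin (k.length + 1) => Fin N)).sum_comp, Fintype.sum_prod_type]
  simp only [Fin.consEquiv, Equiv.coe_fn_mk, Fin.cons_zero, Fin.cons_succ]
  obtain ⟨F, hF⟩ : ∃ F : ℕ → ℚ, F = fun m : ℕ => if t < m then (if 0 ∈ A then 1 / ((N : ℚ) - m) else 1 / (m : ℚ) ^ a) *
        zgi N k (if 0 ∈ A then m - 1 else m) A' else 0 :=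
    ⟨_, rfl⟩
  have e1 : ∀ m : Fin N, (∑ n : Fin k.length → Fin N,
      if (t < (m : ℕ)) ∧ chainC N (k.length + 1) A (Fin.cons m n : Fin (k.length + 1) → Fin N) then
      (if 0 ∈ A then (1 : ℚ) / ((N : ℚ) - ((m : ℕ) : ℚ))
          else (1 : ℚ) / (((m : ℕ) : ℚ) ^ a)) *
      ∏ i : Fin k.length,
          if i ∈ A' then (1 : ℚ) / ((N : ℚ) - ((n i : ℕ) : ℚ))
          else (1 : ℚ) / (((n i : ℕ) : ℚ) ^ k.get i) else 0) =
      F (m : ℕ) := by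
    intro m
    subst hF
    by_cases ht : t < (m : ℕ)
    · simp only [ht, true_and, if_true]
      unfold zgi
      rw [Finset.mul_sum]
      refine Finset.sum_congr rfl fun n _ => ?_
      rw [mul_ite, mul_zero]
      exact if_congr (chain_cons N _ A A' hA m n (by omega)) rfl rfl
    · simp [ht]
  rw [Finset.sum_congr rfl (fun m _ => e1 m), Fin.sum_univ_eq_sum_range F N, hF, ← Finset.sum_filter]
  refine Finset.sum_congr ?_ fun _ _ => rfl
  ext x; simp; tauto

theorem zg_eq_zc (N : ℕ) (k : List ℕ) : ∀ t, zg N k t = zc N k t := by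
  induction k with
  | nil =>
    intro t
    have : ∀ A : Finset (Fin ([] : List ℕ).length), A = ∅ := fun A => by
      ext i; exact i.elim0
    unfold zg zgi
    rw [Fintype.sum_eq_single ∅ (fun A h => absurd (this A) h)]
    simp [chainC, zc]
  | cons a k ih =>
    intro t
    unfold zg
    refine (sum_ps_fin k.length _).trans ?_
    simp only [zc]
    have c1 : ∀ A : Finset (Fin k.length), (∀ i ∈ shF A, (a :: k).get i = 1) ↔
        ∀ i ∈ A, k.get i = 1 := by
      intro A
      refine (Fin.forall_fin_succ (P := fun i => i ∈ shF A → (a :: k).get i = 1)).trans ?_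
      simp only [succ_mem_shF, zero_mem_shF]
      simp
    have c2 : ∀ A : Finset (Fin k.length), (∀ i ∈ insert 0 (shF A), (a :: k).get i = 1) ↔
        a = 1 ∧ ∀ i ∈ A, k.get i = 1 := by
      intro A
      refine (Fin.forall_fin_succ (P := fun i => i ∈ insert 0 (shF A) → (a :: k).get i = 1)).trans ?_
      simp only [succ_mem_ishF]
      simp
    have d1 : ∀ A : Finset (Fin k.length), zgi N (a :: k) t (shF A) = _ := fun A =>
      zgi_cons N a k t (shF A) A (succ_mem_shF A)
    have d2 : ∀ A : Finset (Fin k.length), zgi N (a :: k) t (insert 0 (shF A)) = _ := fun A =>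
      zgi_cons N a k t (insert 0 (shF A)) A (succ_mem_ishF A)
    simp only [zero_mem_shF, Finset.mem_insert_self, if_true, if_false] at d1 d2
    rw [Finset.sum_congr rfl (g := fun A : Finset (Fin k.length) => ∑ m ∈ Finset.Ioo t N,
      ((1 / (m : ℚ) ^ a) * (if ∀ i ∈ A, k.get i = 1 then zgi N k m A else 0) +
       (if a = 1 then 1 / ((N : ℚ) - m) * (if ∀ i ∈ A, k.get i = 1 then zgi N k (m - 1) A else 0)
        else 0)))]
    · rw [Finset.sum_comm]
      refine Finset.sum_congr rfl fun m _ => ?_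
      rw [← ih m, ← ih (m - 1), Finset.sum_add_distrib, ← Finset.mul_sum]
      unfold zg
      split_ifs with h
      · rw [← Finset.mul_sum]; ring
      · simp; ring
    · intro A _
      rw [Finset.sum_add_distrib]
      congr 1
      · rw [d1]
        by_cases h2 : ∀ i ∈ A, k.get i = 1
        · refine (if_pos ((c1 A).2 h2)).trans ?_; simp only [if_pos h2]
        · refine (if_neg (fun h => h2 ((c1 A).1 h))).trans ?_; simp only [if_neg h2]; simp
      · rw [d2]
        by_cases h : a = 1 ∧ ∀ i ∈ A, k.get i = 1
        · refine (if_pos ((c2 A).2 h)).trans ?_; simp only [if_pos h.1, if_pos h.2]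
        · refine (if_neg (fun h' => h ((c2 A).1 h'))).trans ?_
          symm
          refine Finset.sum_eq_zero fun m _ => ?_
          by_cases h1 : a = 1
          · have h2 : ¬ ∀ i ∈ A, k.get i = 1 := fun h2 => h ⟨h1, h2⟩
            simp only [if_neg h2]; simp
          · rw [if_neg h1]

theorem zc_ones (N : ℕ) (b : ℕ) (hb : 0 < b) (l : List ℕ) (a : ℕ) :
    zc N (List.replicate a 1 ++ (b + 1) :: l) = opP N (a + 1) (opQ b (zc N l)) := by
  induction a with
  | zero =>
    funext t
    have : b ≠ 0 := by omega
    simp [zc, opP, opL, opQ, this]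
  | succ a ih =>
    rw [List.replicate_succ, List.cons_append]
    funext t
    change _ = opS N (opP N (a + 1) (opQ b (zc N l))) t
    rw [← ih]
    simp [zc, opS]

theorem zc_ev (N : ℕ) : ∀ c : List ℕ, (∀ x ∈ c, 0 < x) → c.length % 2 = 0 →
    zc N (buildIdx c) = ev N false c
  | [], _, _ => rfl
  | [a], _, h => by simp at h
  | a :: b :: r, hp, hl => by
    have hr : ∀ x ∈ r, 0 < x := fun x hx => hp x (by simp [hx])
    have ha : 0 < a := hp a (by simp)
    have hb : 0 < b := hp b (by simp)
    have hl' : r.length % 2 = 0 := by simp only [List.length_cons] at hl; omega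
    have := zc_ones N b hb (buildIdx r) (a - 1)
    rw [zc_ev N r hr hl', show a - 1 + 1 = a by omega] at this
    simpa [buildIdx, ev] using this

theorem fN_ev (N : ℕ) (c : List ℕ) (hp : ∀ x ∈ c, 0 < x) (hl : c.length % 2 = 0) :
    fN N c = ev N false c 0 := by
  rw [fN, zdiaL_eq_zg, zg_eq_zc, zc_ev N c hp hl]

/-! ### Conclusion -/

theorem sO_fN (N : ℕ) (q : ℚ) (c : List ℕ) (hp : ∀ x ∈ c, 0 < x) (hl : c.length % 2 = 0) :
    sO q c (fN N) = sO q c (ev N false) 0 := by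
  rw [sO_congr q c (fN N) (fun l => ev N false l 0) hp
    (fun l h1 h2 => fN_ev N l h1 (by omega))]
  exact (sO_map q (LinearMap.proj (R := ℚ) (φ := fun _ : ℕ => ℚ) 0) c (ev N false)).symm

theorem sE_fN (N : ℕ) (q : ℚ) (c : List ℕ) (hp : ∀ x ∈ c, 0 < x) (hl : c.length % 2 = 0)
    (hc : c ≠ []) : sE q c (fN N) = sE q c (ev N false) 0 := by
  match c, hc with
  | a :: r, _ =>
    have hr : ∀ x ∈ r, 0 < x := fun x hx => hp x (by simp [hx])
    have ha : 0 < a := hp a (by simp)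
    have key : ∀ a', 0 < a' → sO q r (fun l => fN N (a' :: l)) =
        sO q r (fun l => ev N false (a' :: l)) 0 := by
      intro a' ha'
      rw [sO_congr q r (fun l => fN N (a' :: l)) (fun l => ev N false (a' :: l) 0) hr]
      · exact (sO_map q (LinearMap.proj (R := ℚ) (φ := fun _ : ℕ => ℚ) 0) r
          (fun l => ev N false (a' :: l))).symm
      · intro l h1 h2
        refine fN_ev N _ ?_ ?_
        · intro x hx
          rcases List.mem_cons.1 hx with rfl | hx
          · exact ha'
          · exact h1 x hx
        · simp only [List.length_cons] at hl ⊢; omega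
    simp only [sE]
    rw [key a ha]
    split_ifs with h
    · rw [key _ (by omega)]; simp
    · simp

theorem key_identity (N : ℕ) (hN : 0 < N) (c : List ℕ) (hp : ∀ x ∈ c, 0 < x)
    (hl : c.length % 2 = 0) (hc : c ≠ []) :
    SE (1 / (N : ℚ)) c (fN (N + 1)) = SO (1 / (N : ℚ)) c (fN N) := by
  rw [SE_eq_sE, SO_eq_sO, sE_fN _ _ _ hp hl hc, sO_fN _ _ _ hp hl, main_ev N hN c hp hl hc]

theorem modifyIdx_empty (c : List ℕ) : modifyIdx c ∅ ∅ = c := by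
  unfold modifyIdx
  apply List.ext_getElem
  · simp
  · intro i h1 h2; simp [h2]

theorem cond_small (c : List ℕ) (A B : Finset ℕ) (h : A.card + B.card ≤ 1) :
    condE c A B ↔ condO c A B := by
  have hB : ∀ i, ¬(i ∈ B ∧ i + 1 ∈ B) := by
    rintro i ⟨h1, h2⟩
    have := Finset.card_le_one.1 (show B.card ≤ 1 by omega) _ h1 _ h2
    omega
  have hA : ∀ i j, i ∈ A → j ∈ A → i = j := fun i j h1 h2 =>
    Finset.card_le_one.1 (show A.card ≤ 1 by omega) _ h1 _ h2
  have e1 : EvenOddZ A ↔ A = ∅ := by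
    constructor
    · intro H
      rw [Finset.eq_empty_iff_forall_notMem]
      intro i hi
      obtain ⟨h1, h2⟩ := H i hi
      rcases Nat.mod_two_eq_zero_or_one i with h0 | h0
      · have := hA _ _ hi (h2 h0).2
        have := (h2 h0).1
        omega
      · have := hA _ _ hi (h1 h0)
        omega
    · rintro rfl; intro i hi; simp at hi
  have e2 : OddEvenZ A ↔ A = ∅ := by
    constructor
    · intro H
      rw [Finset.eq_empty_iff_forall_notMem]
      intro i hi
      obtain ⟨h1, h2⟩ := H i hi
      rcases Nat.mod_two_eq_zero_or_one i with h0 | h0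
      · have := hA _ _ hi (h1 h0)
        omega
      · have := hA _ _ hi (h2 h0)
        omega
    · rintro rfl; intro i hi; simp at hi
  unfold condE condO
  rw [e1, e2]
  simp only [hB, not_false_iff, implies_true]

/-- **Difference equation.**  (Note that `(-1)^{#B-1} = (-1)^{#B+1}`.) -/
theorem difference_equation (N s : ℕ) (hNpos : 0 < N) (hs : 0 < s) (c : List ℕ)
    (hlen : c.length = 2 * s) (hpos : ∀ x ∈ c, 0 < x) :
    dfN N c =
      (∑ A ∈ (Finset.range c.length).powerset,
        ∑ B ∈ (Finset.range c.length).powerset,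
          if (∀ i ∈ A, c.getD i 0 = 1) ∧ EvenOddZ A ∧
              (∀ i ∈ B, 2 ≤ c.getD i 0) ∧ 1 ≤ A.card + B.card ∧
              (∀ i, i % 2 = 1 → ¬(i ∈ B ∧ i + 1 ∈ B)) then
            (-1 : ℚ) ^ (B.card + 1) * (1 / (N : ℚ)) ^ (A.card + B.card) *
              dfN N (modifyIdx c A B)
          else 0)
      +
      (∑ A ∈ (Finset.range c.length).powerset,
        ∑ B ∈ (Finset.range c.length).powerset,
          if (∀ i ∈ A, c.getD i 0 = 1) ∧ EvenOddZ A ∧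
              (∀ i ∈ B, 2 ≤ c.getD i 0) ∧ 2 ≤ A.card + B.card ∧
              (∀ i, i % 2 = 1 → ¬(i ∈ B ∧ i + 1 ∈ B)) then
            (-1 : ℚ) ^ (B.card + 1) * (1 / (N : ℚ)) ^ (A.card + B.card) *
              fN N (modifyIdx c A B)
          else 0)
      +
      (∑ A ∈ (Finset.range c.length).powerset,
        ∑ B ∈ (Finset.range c.length).powerset,
          if (∀ i ∈ A, c.getD i 0 = 1) ∧ OddEvenZ A ∧
              (∀ i ∈ B, 2 ≤ c.getD i 0) ∧ 2 ≤ A.card + B.card ∧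
              (∀ i, i % 2 = 0 → ¬(i ∈ B ∧ i + 1 ∈ B)) then
            (-1 : ℚ) ^ B.card * (1 / (N : ℚ)) ^ (A.card + B.card) *
              fN N (modifyIdx c A B)
          else 0) := by
  have hl : c.length % 2 = 0 := by omega
  have hc : c ≠ [] := by rintro rfl; simp at hlen; omega
  have key := key_identity N hNpos c hpos hl hc
  set q : ℚ := 1 / (N : ℚ) with hq
  have s1 : ∀ A B : Finset ℕ, (if (∀ i ∈ A, c.getD i 0 = 1) ∧ EvenOddZ A ∧
              (∀ i ∈ B, 2 ≤ c.getD i 0) ∧ 1 ≤ A.card + B.card ∧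
              (∀ i, i % 2 = 1 → ¬(i ∈ B ∧ i + 1 ∈ B)) then
            (-1 : ℚ) ^ (B.card + 1) * q ^ (A.card + B.card) *
              dfN N (modifyIdx c A B)
          else 0) = (if A = ∅ then (if B = ∅ then dfN N c else 0) else 0)
            - tE q c (dfN N) A B := by
    intro A B
    by_cases h0 : A.card + B.card = 0
    · have hA : A = ∅ := by rw [← Finset.card_eq_zero]; omega
      have hB : B = ∅ := by rw [← Finset.card_eq_zero]; omega
      subst hA hB
      simp [tE, condE, EvenOddZ, modifyIdx_empty]
    · have h1 : 1 ≤ A.card + B.card := by omega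
      have h2 : (if A = ∅ then (if B = ∅ then dfN N c else 0) else 0) = 0 := by
        split_ifs with hA hB
        · subst hA hB; simp at h0
        · rfl
        · rfl
      rw [h2, tE]
      by_cases hcd : condE c A B
      · rw [if_pos hcd, if_pos ⟨hcd.1, hcd.2.1, hcd.2.2.1, h1, hcd.2.2.2⟩]; ring
      · rw [if_neg hcd, if_neg (fun h => hcd ⟨h.1, h.2.1, h.2.2.1, h.2.2.2.2⟩)]; ring
  have s2 : ∀ A B : Finset ℕ, (if (∀ i ∈ A, c.getD i 0 = 1) ∧ EvenOddZ A ∧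
              (∀ i ∈ B, 2 ≤ c.getD i 0) ∧ 2 ≤ A.card + B.card ∧
              (∀ i, i % 2 = 1 → ¬(i ∈ B ∧ i + 1 ∈ B)) then
            (-1 : ℚ) ^ (B.card + 1) * q ^ (A.card + B.card) *
              fN N (modifyIdx c A B)
          else 0) + (if (∀ i ∈ A, c.getD i 0 = 1) ∧ OddEvenZ A ∧
              (∀ i ∈ B, 2 ≤ c.getD i 0) ∧ 2 ≤ A.card + B.card ∧
              (∀ i, i % 2 = 0 → ¬(i ∈ B ∧ i + 1 ∈ B)) then
            (-1 : ℚ) ^ B.card * q ^ (A.card + B.card) *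
              fN N (modifyIdx c A B)
          else 0) = tO q c (fN N) A B - tE q c (fN N) A B := by
    intro A B
    by_cases h0 : 2 ≤ A.card + B.card
    · unfold tO tE
      rw [add_comm, sub_eq_add_neg]
      congr 1
      · refine if_congr ?_ rfl rfl
        exact ⟨fun h => ⟨h.1, h.2.1, h.2.2.1, h.2.2.2.2⟩,
          fun h => ⟨h.1, h.2.1, h.2.2.1, h0, h.2.2.2⟩⟩
      · by_cases hcd : condE c A B
        · rw [if_pos hcd, if_pos ⟨hcd.1, hcd.2.1, hcd.2.2.1, h0, hcd.2.2.2⟩]; ring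
        · rw [if_neg hcd, if_neg (fun h => hcd ⟨h.1, h.2.1, h.2.2.1, h.2.2.2.2⟩)]; ring
    · rw [if_neg (fun h => h0 h.2.2.2.1), if_neg (fun h => h0 h.2.2.2.1)]
      unfold tO tE
      rw [if_congr (cond_small c A B (by omega)) rfl rfl]
      ring
  have s3 : ∀ A B : Finset ℕ, tE q c (dfN N) A B = tE q c (fN (N + 1)) A B - tE q c (fN N) A B := by
    intro A B
    unfold tE dfN
    split_ifs <;> ring
  rw [add_assoc, ← Finset.sum_add_distrib]
  simp only [← Finset.sum_add_distrib]
  simp only [s1, s2, s3]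
  simp only [Finset.sum_add_distrib, Finset.sum_sub_distrib]
  change _ = _ - (SE q c (fN (N + 1)) - SE q c (fN N)) + (SO q c (fN N) - SE q c (fN N))
  rw [key]
  have e : (∑ A ∈ (Finset.range c.length).powerset, ∑ B ∈ (Finset.range c.length).powerset,
      (if A = ∅ then (if B = ∅ then dfN N c else 0) else 0)) = dfN N c := by
    rw [Finset.sum_eq_single ∅]
    · rw [Finset.sum_eq_single ∅]
      · simp
      · intro B _ hB; simp [hB]
      · intro h; simp at h
    · intro A _ hA; simp [hA]
    · intro h; simp at h
  rw [e]
  ring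
end
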